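/- Let $d,m\ge 1$, $M=\{1,\dots,m\}$, and write $B(x,r)$ for the open ball; a domain is a nonempty connected open set. Assume the following. (A1) For each $i\in M$, $b(\cdot,i):\mathbb R^d\to\mathbb R^d$ and $\sigma(\cdot,i):\mathbb R^d\to\mathbb R^{d\times d}$ are continuous with $\sum_{k,l}|\sigma_{kl}(x,i)|+\sum_k|b_k(x,i)|\le c(1+|x|)$ for some $c>0$; $Q(x)=(q_{ij}(x))$ is an $m\times m$ matrix of bounded Borel functions with $q_{ij}\ge 0$ for $i\ne j$ and $\sum_{j}q_{ij}=0$. (A2) With $a=\sigma\sigma^{\mathsf T}$: for every bounded domain $D\subset\mathbb R^d$ there is $\kappa_0\in(0,1]$ with $\kappa_0|\xi|^2\le \xi^{\mathsf T}a(x,i)\xi\le\kappa_0^{-1}|\xi|^2$ for all $\xi\in\mathbb R^d$, $x\in D$, $i\in M$. (A3) $\pi_i(x,dz)=\tilde\pi_i(x,z)\,dz$ with $\tilde\pi_i\ge 0$ Borel on $\mathbb R^d\times\mathbb R^d$ and $\int(1\wedge|z|^2)\,\pi_i(x,dz)<\infty$; $\sup_{x,i}\pi_i(x,B(0,1)^c)<\infty$;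 $\int_{B(0,1)}|z|^2\,\pi_i(x,dz)\le c'(1+|x|^2)$ for some $c'>0$ and all $x,i$; and for every integer $n\ge1$ there is a $\sigma$-finite measure $\Pi_n$ with $\int(1\wedge|z|^2)\,\Pi_n(dz)<\infty$ and $\pi_i(x,\cdot)\le\Pi_n$ for all $x\in B(0,n)$, $i\in M$. (A4) There are $\kappa_2,\beta>0$ and, for each $r\in(0,1)$, a number $\alpha_r$ with $1<\alpha_r<\kappa_2r^{-\beta}$ such that $\tilde\pi_i(x,z-x)\le\alpha_r\,\tilde\pi_i(y,z-y)$ for all $x_0\in\mathbb R^d$, $x,y\in B(x_0,r/2)$, $z\in B(x_0,r)^c$, $i\in M$. For $f:\mathbb R^d\times M\to\mathbb R$ with $f(\cdot,i)\in C^2(\mathbb R^d)$ for each $i$, let $$\mathcal Gf(x,i)=\tfrac12\sum_{k,l}a_{kl}(x,i)\,\partial_{kl}f(x,i)+\sum_kb_k(x,i)\,\partial_kf(x,i)+\int_{\mathbb R^d}\bigl[f(x+z,i)-f(x,i)-\nabla f(x,i)\cdot z\,\mathbf 1_{\{|z|<1\}}\bigr]\pi_i(x,dz)+\sum_{j\in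 M}q_{ij}(x)f(x,j).$$ Let $(X(t),\Lambda(t))_{t\ge0}$ be the coordinate process on the space of càdlàg paths $[0,\infty)\to\mathbb R^d\times M$, with its right-continuous filtration, and let $(P_{x,i})$ be probability measures on this space, measurable in $(x,i)$, which have the strong Markov property and such that, for each $(x,i)$, $P_{x,i}$ is the unique solution of the martingale problem for $(\mathcal G,C_b^2(\mathbb R^d))$ started at $(x,i)$: $P_{x,i}(X(0)=x,\Lambda(0)=i)=1$ and, whenever each $f(\cdot,j)$ is $C^2$ and bounded together with its partial derivatives up to order $2$, the process $f(X(t),\Lambda(t))-f(x,i)-\int_0^t\mathcal Gf(X(s),\Lambda(s))\,ds$ is a $P_{x,i}$-martingale. Suppose that $\mathcal G$ is strictly irreducible on every bounded domain $E\subset\mathbb R^d$, that is, $\inf_{x\in E}q_{ij}(x)>0$ for all $i\ne j$ in $M$. Let $D\subset\mathbb R^d$ be a bounded domain and suppose that $P_{y,j}(\sigma_D<\infty)=1$ for every $(y,j)\in D^c\times M$, where $\sigma_D=\inf\{t\ge0:X(t)\in D\}$. Then for every $(x,i)\in\mathbb R^d\times M$ and every $l\in M$, $$P_{x,i}(\sigma_{D\times\{l\}}<\infty)=1,\qquad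 \sigma_{D\times\{l\}}=\inf\{t\ge0:X(t)\in D,\ \Lambda(t)=l\}.$$ -/

import Mathlib

open MeasureTheory Set Filter Metric Matrix
open scoped NNReal ENNReal Topology

noncomputable section

/-- Euclidean space `ℝ^d`. -/
abbrev Rd (d : ℕ) : Type := EuclideanSpace ℝ (Fin d)

/-- The state space `ℝ^d × M`, with the `m` regimes indexed by `Fin m`. -/
abbrev State (d m : ℕ) : Type := Rd d × Fin m

/-- A bounded domain of `ℝ^d`: a nonempty connected bounded open set. -/
def BddDomain {d : ℕ} (D : Set (Rd d)) : Prop :=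
  IsOpen D ∧ IsConnected D ∧ Bornology.IsBounded D

/-- A right continuous path with left limits in `ℝ^d × M`. -/
def IsCadlag {d m : ℕ} (w : ℝ≥0 → State d m) : Prop :=
  (∀ t, ContinuousWithinAt w (Ici t) t) ∧
    ∀ t, 0 < t → ∃ L : State d m, Tendsto w (𝓝[<] t) (𝓝 L)

/-- The canonical path space `D([0,∞), ℝ^d × M)`. -/
def CadlagPath (d m : ℕ) : Type := {w : ℝ≥0 → State d m // IsCadlag w}

namespace CadlagPath

variable {d m : ℕ}

/-- The canonical process `(X(t), Λ(t))`. -/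
def Z (t : ℝ≥0) (w : CadlagPath d m) : State d m := w.1 t

/-- The component `X(t)`. -/
def X (t : ℝ≥0) (w : CadlagPath d m) : Rd d := (Z t w).1

/-- The component `Λ(t)`. -/
def Λ (t : ℝ≥0) (w : CadlagPath d m) : Fin m := (Z t w).2

/-- The σ-algebra generated by the coordinate maps (which is the Borel σ-algebra of the
Skorokhod topology). -/
instance instMeasurableSpace : MeasurableSpace (CadlagPath d m) :=
  ⨆ t : ℝ≥0, MeasurableSpace.comap (Z t) inferInstance

theorem measurable_Z (t : ℝ≥0) : Measurable (Z (d := d) (m := m) t) :=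
  Measurable.of_comap_le (le_iSup (fun t : ℝ≥0 => MeasurableSpace.comap (Z t) inferInstance) t)

/-- The right continuous filtration generated by the canonical process. -/
def filt (d m : ℕ) : Filtration ℝ≥0 (instMeasurableSpace (d := d) (m := m)) :=
  (Filtration.natural Z fun t => (measurable_Z t).stronglyMeasurable).rightCont

/-- The path `t ↦ w(s + t)`. -/
def shift (s : ℝ≥0) (w : CadlagPath d m) : CadlagPath d m :=
  ⟨fun t => w.1 (s + t), by
    refine ⟨fun t => ?_, fun t ht => ?_⟩
    · exact (w.2.1 (s + t)).comp (f := fun u : ℝ≥0 => s + u)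
        (continuous_const.add continuous_id).continuousWithinAt
        fun u hu => add_le_add_right (mem_Ici.1 hu) s
    · obtain ⟨L, hL⟩ := w.2.2 (s + t) (add_pos_of_nonneg_of_pos zero_le ht)
      refine ⟨L, hL.comp (tendsto_nhdsWithin_iff.2 ⟨?_, ?_⟩)⟩
      · exact ((continuous_const.add continuous_id).tendsto t).mono_left nhdsWithin_le_nhds
      · exact eventually_nhdsWithin_of_forall fun u hu => add_lt_add_right (mem_Iio.1 hu) s⟩

/-- `σ_D = inf {t ≥ 0 : X(t) ∈ D}`, with `inf ∅ = ∞`. -/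
def sigmaX (D : Set (Rd d)) (w : CadlagPath d m) : ℝ≥0∞ :=
  ⨅ (t : ℝ≥0) (_ : X t w ∈ D), (t : ℝ≥0∞)

/-- `σ_U = inf {t ≥ 0 : (X(t), Λ(t)) ∈ U}`, with `inf ∅ = ∞`. -/
def sigmaZ (U : Set (State d m)) (w : CadlagPath d m) : ℝ≥0∞ :=
  ⨅ (t : ℝ≥0) (_ : Z t w ∈ U), (t : ℝ≥0∞)

end CadlagPath

/-- The coefficients of a regime-switching jump diffusion. -/
structure Coeff (d m : ℕ) where
  /-- drift `b(x,i)` -/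
  b : Rd d → Fin m → Rd d
  /-- diffusion coefficient `σ(x,i)` -/
  sig : Rd d → Fin m → Matrix (Fin d) (Fin d) ℝ
  /-- switching rates `q_{ij}(x)` -/
  q : Rd d → Fin m → Fin m → ℝ
  /-- jump density `π̃_i(x,z)` -/
  pit : Rd d → Fin m → Rd d → ℝ

namespace Coeff

variable {d m : ℕ}

/-- `a = σ σᵀ` -/
def a (C : Coeff d m) (x : Rd d) (i : Fin m) : Matrix (Fin d) (Fin d) ℝ :=
  C.sig x i * (C.sig x i)ᵀ

/-- the jump measure `π_i(x,dz) = π̃_i(x,z) dz` -/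
def jump (C : Coeff d m) (x : Rd d) (i : Fin m) : Measure (Rd d) :=
  volume.withDensity fun z => ENNReal.ofReal (C.pit x i z)

/-- The generator
`Gf(x,i) = ½ Σ a_{kl} ∂²f/∂x_k∂x_l + Σ b_k ∂f/∂x_k
  + ∫ [f(x+z,i) − f(x,i) − ∇f(x,i)·z 1_{|z|<1}] π_i(x,dz) + Σ_j q_{ij}(x) f(x,j)`. -/
def G (C : Coeff d m) (f : Rd d → Fin m → ℝ) (x : Rd d) (i : Fin m) : ℝ :=
  (1 / 2) * ∑ k, ∑ l, C.a x i k l *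
      iteratedFDeriv ℝ 2 (fun y => f y i) x
        ![EuclideanSpace.single k (1 : ℝ), EuclideanSpace.single l (1 : ℝ)]
    + ∑ k, C.b x i k * fderiv ℝ (fun y => f y i) x (EuclideanSpace.single k (1 : ℝ))
    + ∫ z, (f (x + z) i - f x i -
        (if ‖z‖ < 1 then fderiv ℝ (fun y => f y i) x z else 0)) ∂(C.jump x i)
    + ∑ j, C.q x i j * f x j

/-- The standing assumptions on the coefficients. -/
structure Admissible (C : Coeff d m) : Prop where
  sig_cont : ∀ i, Continuous fun x => C.sig x i
  b_cont : ∀ i, Continuous fun x => C.b x i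
  growth : ∃ c > (0 : ℝ), ∀ x i,
    (∑ k, ∑ l, |C.sig x i k l|) + ∑ k, |C.b x i k| ≤ c * (1 + ‖x‖)
  q_meas : ∀ i j, Measurable fun x => C.q x i j
  q_bdd : ∀ i j, ∃ K : ℝ, ∀ x, |C.q x i j| ≤ K
  q_nonneg : ∀ x i j, i ≠ j → 0 ≤ C.q x i j
  q_rowsum : ∀ x i, ∑ j, C.q x i j = 0
  ellipticity : ∀ D : Set (Rd d), BddDomain D →
    ∃ κ₀ ∈ Ioc (0 : ℝ) 1, ∀ x ∈ D, ∀ (i : Fin m) (ξ : Rd d),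
      κ₀ * ‖ξ‖ ^ 2 ≤ ∑ k, ∑ l, ξ k * C.a x i k l * ξ l ∧
      ∑ k, ∑ l, ξ k * C.a x i k l * ξ l ≤ κ₀⁻¹ * ‖ξ‖ ^ 2
  pit_nonneg : ∀ x i z, 0 ≤ C.pit x i z
  pit_meas : ∀ i, Measurable fun p : Rd d × Rd d => C.pit p.1 i p.2
  levy : ∀ x i, ∫⁻ z, ENNReal.ofReal (min 1 (‖z‖ ^ 2)) ∂(C.jump x i) < ⊤
  big_jumps : ∃ K : ℝ≥0∞, K < ⊤ ∧ ∀ x i, C.jump x i (ball (0 : Rd d) 1)ᶜ ≤ K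
  small_jumps : ∃ c > (0 : ℝ), ∀ x i,
    ∫⁻ z in ball (0 : Rd d) 1, ENNReal.ofReal (‖z‖ ^ 2) ∂(C.jump x i)
      ≤ ENNReal.ofReal (c * (1 + ‖x‖ ^ 2))
  domination : ∀ n : ℕ, 1 ≤ n → ∃ Pin : Measure (Rd d), SigmaFinite Pin ∧
    ∫⁻ z, ENNReal.ofReal (min 1 (‖z‖ ^ 2)) ∂Pin < ⊤ ∧
    ∀ x ∈ ball (0 : Rd d) n, ∀ i, C.jump x i ≤ Pin
  comparability : ∃ κ₂ > (0 : ℝ), ∃ β > (0 : ℝ), ∀ r ∈ Ioo (0 : ℝ) 1, ∃ αr : ℝ,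
    1 < αr ∧ αr < κ₂ * r ^ (-β) ∧
    ∀ (x₀ x y z : Rd d) (i : Fin m), x ∈ ball x₀ (r / 2) → y ∈ ball x₀ (r / 2) →
      z ∉ ball x₀ r → C.pit x i (z - x) ≤ αr * C.pit y i (z - y)

/-- `G` is strictly irreducible on `D`. -/
def StrictlyIrreducible (C : Coeff d m) (D : Set (Rd d)) : Prop :=
  ∀ i j : Fin m, i ≠ j → ∃ q0 > (0 : ℝ), ∀ x ∈ D, q0 ≤ C.q x i j

end Coeff

/-- `f(·,i) ∈ C_b²(ℝ^d)` for every `i`: the partial derivatives of orders `0, 1, 2` exist, are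
continuous and bounded. -/
def IsCb2 {d m : ℕ} (f : Rd d → Fin m → ℝ) : Prop :=
  ∀ i, (ContDiff ℝ 2 fun y => f y i) ∧
    ∃ K : ℝ, ∀ x, |f x i| ≤ K ∧ ‖fderiv ℝ (fun y => f y i) x‖ ≤ K ∧
      ‖iteratedFDeriv ℝ 2 (fun y => f y i) x‖ ≤ K

/-- `μ` is a solution of the martingale problem for `(G, C_b²(ℝ^d))` started at `(x,i)`. -/
structure SolvesMartingaleProblem {d m : ℕ} (C : Coeff d m) (x : Rd d) (i : Fin m)
    (μ : Measure (CadlagPath d m)) : Prop where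
  prob : IsProbabilityMeasure μ
  init : μ {w | CadlagPath.X 0 w = x ∧ CadlagPath.Λ 0 w = i} = 1
  martingale : ∀ f : Rd d → Fin m → ℝ, IsCb2 f →
    Martingale
      (fun (t : ℝ≥0) (w : CadlagPath d m) => f (CadlagPath.X t w) (CadlagPath.Λ t w) - f x i -
        ∫ s in (0 : ℝ)..(t : ℝ), C.G f (CadlagPath.X s.toNNReal w) (CadlagPath.Λ s.toNNReal w))
      (CadlagPath.filt d m) μ

/-- The strong Markov property of the family of laws `P` on path space: for every stopping time
`τ`, conditionally on `F_τ` and on `{τ < ∞}`, the path after `τ` has law `P_{X(τ),Λ(τ)}`. -/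
def StrongMarkov {d m : ℕ} (P : ProbabilityTheory.Kernel (State d m) (CadlagPath d m)) : Prop :=
  ∀ (p : State d m) (τ : CadlagPath d m → WithTop ℝ≥0) (hτ : IsStoppingTime (CadlagPath.filt d m) τ)
    (A : Set (CadlagPath d m)), MeasurableSet[hτ.measurableSpace] A →
    ∀ B : Set (CadlagPath d m), MeasurableSet B →
      P p {w | w ∈ A ∧ τ w ≠ ⊤ ∧ CadlagPath.shift (τ w).untopA w ∈ B} =
        ∫⁻ w in {w | w ∈ A ∧ τ w ≠ ⊤}, P (CadlagPath.Z (τ w).untopA w) B ∂(P p)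

/-- The family of laws `P_{x,i}`, a kernel from `ℝ^d × M` to path space, is that of the
switching jump diffusion with coefficients `C`: it is strong Markov and `P_{x,i}` is the unique
solution of the martingale problem for `(G, C_b²(ℝ^d))` started at `(x,i)`. Since the paths live
in `ℝ^d × M` for all times, the process is conservative. -/
structure IsSwitchingJumpDiffusion {d m : ℕ} (C : Coeff d m)
    (P : ProbabilityTheory.Kernel (State d m) (CadlagPath d m)) : Prop where
  solves : ∀ x i, SolvesMartingaleProblem C x i (P (x, i))
  unique : ∀ x i (μ : Measure (CadlagPath d m)), SolvesMartingaleProblem C x i μ → μ = P (x, i)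
  strongMarkov : StrongMarkov P

end

section

namespace CadlagPath

variable {d m : ℕ}

/-- A càdlàg path is Borel measurable in time. -/
theorem measurable_path (w : CadlagPath d m) : Measurable fun s : ℝ≥0 => Z s w := by
  let r : ℕ → ℝ≥0 → ℝ≥0 := fun n s => ((⌊s * (n + 1)⌋₊ : ℝ≥0) + 1) / (n + 1)
  have hmeas : ∀ n, Measurable fun s => Z (r n s) w := fun n =>
    (measurable_from_nat (f := fun k : ℕ => Z (((k : ℝ≥0) + 1) / (n + 1)) w)).comp
      (Nat.measurable_floor.comp (measurable_id.mul_const _))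
  refine measurable_of_tendsto_metrizable hmeas (tendsto_pi_nhds.2 fun s => ?_)
  have hlow : ∀ n, s ≤ r n s := fun n => by
    rw [le_div_iff₀ (by positivity)]
    exact (Nat.lt_floor_add_one _).le
  have hup : ∀ n, r n s ≤ s + 1 / (n + 1) := fun n => by
    rw [div_le_iff₀ (by positivity), add_mul, div_mul_cancel₀ _ (by positivity)]
    gcongr
    exact Nat.floor_le zero_le
  have hr : Tendsto (fun n => r n s) atTop (𝓝 s) := by
    refine tendsto_of_tendsto_of_tendsto_of_le_of_le tendsto_const_nhds ?_ hlow hup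
    simpa using (tendsto_one_div_add_atTop_nhds_zero_nat (𝕜 := ℝ≥0)).const_add s
  exact (w.2.1 s).tendsto.comp (tendsto_nhdsWithin_iff.2 ⟨hr, .of_forall hlow⟩)

/-- A càdlàg path is bounded on compact time intervals. -/
theorem exists_norm_le (w : CadlagPath d m) (T : ℝ≥0) :
    ∃ N : ℝ, ∀ s ≤ T, ‖X s w‖ ≤ N := by
  have key : ∃ N : ℝ, ∀ s ∈ Icc 0 T, ‖X s w‖ ≤ N := by
    refine (isCompact_Icc (a := (0 : ℝ≥0)) (b := T)).induction_on
      (p := fun S => ∃ N : ℝ, ∀ s ∈ S, ‖X s w‖ ≤ N) ⟨0, by simp⟩ ?_ ?_ ?_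
    · rintro S S' h ⟨N, hN⟩
      exact ⟨N, fun s hs => hN s (h hs)⟩
    · rintro S S' ⟨N, hN⟩ ⟨N', hN'⟩
      exact ⟨max N N', fun s hs => hs.elim (fun h => (hN s h).trans (le_max_left _ _))
        fun h => (hN' s h).trans (le_max_right _ _)⟩
    · intro s _
      have bdd : ∀ (l : Filter ℝ≥0) (L : State d m), Tendsto w.1 l (𝓝 L) →
          ∀ᶠ t in l, ‖X t w‖ ≤ ‖L.1‖ + 1 := fun l L hL =>
        (((continuous_fst.tendsto L).comp hL).norm.eventually
          (gt_mem_nhds (lt_add_one _))).mono fun t ht => ht.le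
      obtain ⟨N, hN⟩ : ∃ N : ℝ, ∀ᶠ t in 𝓝[<] s, ‖X t w‖ ≤ N := by
        rcases eq_zero_or_pos s with rfl | hs
        · refine ⟨0, ?_⟩
          simp
        · obtain ⟨L, hL⟩ := w.2.2 s hs
          exact ⟨_, bdd _ L hL⟩
      have hR := bdd _ _ (w.2.1 s)
      have hU : ∀ᶠ t in 𝓝 s, ‖X t w‖ ≤ max N (‖(w.1 s).1‖ + 1) := by
        rw [← nhdsLT_sup_nhdsGE, eventually_sup]
        exact ⟨hN.mono fun t h => h.trans (le_max_left _ _),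
          hR.mono fun t h => h.trans (le_max_right _ _)⟩
      exact ⟨_, mem_nhdsWithin_of_mem_nhds hU, _, fun t ht => ht⟩
  obtain ⟨N, hN⟩ := key
  exact ⟨N, fun s hs => hN s ⟨zero_le, hs⟩⟩

/-- If a path is in an open set, it remains there for some time. -/
theorem exists_stay (w : CadlagPath d m) {V : Set (State d m)} (hV : IsOpen V) {t : ℝ≥0}
    (ht : Z t w ∈ V) : ∃ u > t, ∀ s ∈ Ico t u, Z s w ∈ V :=
  mem_nhdsGE_iff_exists_Ico_subset.1 ((w.2.1 t).eventually (hV.mem_nhds ht))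

/-- A path visits an open set if and only if it does so at a rational time. -/
theorem exists_mem_iff_rat (w : CadlagPath d m) {V : Set (State d m)} (hV : IsOpen V) :
    (∃ t, Z t w ∈ V) ↔ ∃ q : ℚ, Z (Real.toNNReal q) w ∈ V := by
  refine ⟨fun ⟨t, ht⟩ => ?_, fun ⟨q, hq⟩ => ⟨_, hq⟩⟩
  obtain ⟨u, hu, h⟩ := w.exists_stay hV ht
  obtain ⟨q, hq1, hq2⟩ := exists_rat_btwn (NNReal.coe_lt_coe.2 hu)
  refine ⟨q, h _ ⟨?_, ?_⟩⟩
  · exact NNReal.le_toNNReal_of_coe_le hq1.le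
  · exact (Real.toNNReal_lt_iff_lt_coe (t.2.trans hq1.le)).2 hq2

theorem sigmaZ_lt_top_iff (U : Set (State d m)) (w : CadlagPath d m) :
    sigmaZ U w < ⊤ ↔ ∃ t, Z t w ∈ U := by
  simp [sigmaZ, iInf_lt_iff]

theorem sigmaX_lt_top_iff (D : Set (Rd d)) (w : CadlagPath d m) :
    sigmaX D w < ⊤ ↔ ∃ t, X t w ∈ D := by
  simp [sigmaX, iInf_lt_iff]

theorem measurableSet_exists_mem {V : Set (State d m)} (hV : IsOpen V) :
    MeasurableSet {w : CadlagPath d m | ∃ t, Z t w ∈ V} := by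
  simp_rw [exists_mem_iff_rat _ hV, ofPred_exists]
  exact MeasurableSet.iUnion fun q => measurable_Z _ hV.measurableSet

theorem measurable_Z_filt {s t : ℝ≥0} (h : s ≤ t) :
    Measurable[filt d m t] (Z (d := d) (m := m) s) := by
  have h1 := Filtration.stronglyAdapted_natural
    (fun t => (measurable_Z (d := d) (m := m) t).stronglyMeasurable) s
  exact h1.measurable.mono (((Filtration.natural Z _).mono h).trans
    (Filtration.le_rightCont _ t)) le_rfl

end CadlagPath

open CadlagPath

variable {d m : ℕ} {P : ProbabilityTheory.Kernel (State d m) (CadlagPath d m)}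

/-- The Markov property at a deterministic time. -/
theorem StrongMarkov.markov (hP : StrongMarkov P) (p : State d m) (t : ℝ≥0)
    {A B : Set (CadlagPath d m)} (hA : MeasurableSet[filt d m t] A) (hB : MeasurableSet B) :
    P p {w | w ∈ A ∧ shift t w ∈ B} = ∫⁻ w in A, P (Z t w) B ∂(P p) := by
  have hτ := isStoppingTime_const (filt d m) t
  have hA' : MeasurableSet[hτ.measurableSpace] A := by
    rwa [IsStoppingTime.measurableSpace_const]
  have ht : (t : WithTop ℝ≥0) ≠ ⊤ := WithTop.coe_ne_top
  have hu : (t : WithTop ℝ≥0).untopA = t := rfl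
  have hAe : {w | w ∈ A ∧ (t : WithTop ℝ≥0) ≠ ⊤} = A := by
    ext w
    exact and_iff_left ht
  have hAB : {w | w ∈ A ∧ (t : WithTop ℝ≥0) ≠ ⊤ ∧ shift (t : WithTop ℝ≥0).untopA w ∈ B} =
      {w | w ∈ A ∧ shift t w ∈ B} := by
    ext w
    exact and_congr_right fun _ => by rw [hu]; exact and_iff_right ht
  have := hP p (fun _ => (t : WithTop ℝ≥0)) hτ A hA' B hB
  rwa [hAe, hAB, hu] at this

/-- A uniform positive lower bound for the probability of visiting an open set implies that this
set is visited almost surely. -/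
theorem StrongMarkov.prob_exists_mem_eq_one (hP : StrongMarkov P)
    [ProbabilityTheory.IsMarkovKernel P] {V : Set (State d m)} (hV : IsOpen V) {δ : ℝ≥0∞}
    (hδ : 0 < δ) (h : ∀ p, δ ≤ P p {w | ∃ t, Z t w ∈ V}) (p : State d m) :
    P p {w | ∃ t, Z t w ∈ V} = 1 := by
  set H : Set (CadlagPath d m) := {w | ∃ t, Z t w ∈ V} with hH
  have hHm : MeasurableSet H := measurableSet_exists_mem hV
  have hc : ∀ p, P p Hᶜ ≤ 1 - δ := fun p => by
    rw [prob_compl_eq_one_sub hHm]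
    exact tsub_le_tsub_left (h p) 1
  let A : ℕ → Set (CadlagPath d m) :=
    fun n => {w | ∀ q : ℚ, Real.toNNReal q ≤ n → Z (Real.toNNReal q) w ∉ V}
  have hA : ∀ n : ℕ, MeasurableSet[filt d m (n : ℝ≥0)] (A n) := fun n => by
    simp_rw [A, ofPred_forall]
    refine MeasurableSet.iInter fun q => MeasurableSet.iInter fun hq => ?_
    exact (measurable_Z_filt hq) hV.measurableSet.compl
  have hAm : ∀ n, MeasurableSet (A n) := fun n => (filt d m).le _ _ (hA n)
  have hle : ∀ n, P p Hᶜ ≤ (1 - δ) * P p (A n) := fun n => by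
    calc P p Hᶜ ≤ P p {w | w ∈ A n ∧ shift n w ∈ Hᶜ} :=
          measure_mono fun w hw => ⟨fun q _ hq => hw ⟨_, hq⟩, fun ⟨t, ht⟩ => hw ⟨_, ht⟩⟩
      _ = ∫⁻ w in A n, P (Z n w) Hᶜ ∂(P p) := hP.markov p n (hA n) hHm.compl
      _ ≤ ∫⁻ _ in A n, (1 - δ) ∂(P p) := lintegral_mono fun w => hc _
      _ = (1 - δ) * P p (A n) := by simp
  have hInter : ⋂ n, A n = Hᶜ := by
    ext w
    simp only [mem_iInter, A, hH, mem_compl_iff, mem_ofPred_eq, exists_mem_iff_rat w hV, not_exists]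
    refine ⟨fun hw q => ?_, fun hw n q _ => hw q⟩
    obtain ⟨n, hn⟩ := exists_nat_ge (Real.toNNReal q)
    exact hw n q hn
  have hlim : Tendsto (fun n => P p (A n)) atTop (𝓝 (P p Hᶜ)) := by
    rw [← hInter]
    refine tendsto_measure_iInter_atTop (fun n => (hAm n).nullMeasurableSet) ?_
      ⟨0, measure_ne_top _ _⟩
    intro a b hab w hw q hq
    exact hw q (hq.trans (by exact_mod_cast hab))
  have hfin : P p Hᶜ ≤ (1 - δ) * P p Hᶜ :=
    ge_of_tendsto' (ENNReal.Tendsto.const_mul hlim (Or.inr (by simp))) hle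
  have hz : P p Hᶜ = 0 := by
    by_contra hne
    have hlt : 1 - δ < 1 := ENNReal.sub_lt_self (by simp) (by simp) hδ.ne'
    have := (ENNReal.mul_lt_mul_iff_left hne (measure_ne_top _ _)).2 hlt
    rw [one_mul] at this
    exact absurd hfin this.not_ge
  exact (prob_compl_eq_zero_iff hHm).1 hz

/-- If the process surely visits the open set `W`, and from each point of `W` it visits `V` with
probability at least `δ`, then it visits `V` with probability at least `δ`. -/
theorem StrongMarkov.le_prob_exists_mem (hP : StrongMarkov P)
    [ProbabilityTheory.IsMarkovKernel P] {V W : Set (State d m)} (hV : IsOpen V) (hW : IsOpen W)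
    {δ : ℝ≥0∞} (h : ∀ p ∈ W, δ ≤ P p {w | ∃ t, Z t w ∈ V}) (p : State d m)
    (hp : P p {w | ∃ t, Z t w ∈ W} = 1) : δ ≤ P p {w | ∃ t, Z t w ∈ V} := by
  set H : Set (CadlagPath d m) := {w | ∃ t, Z t w ∈ V} with hH
  have hHm : MeasurableSet H := measurableSet_exists_mem hV
  let t : ℕ → ℕ → ℝ≥0 := fun n k => k / 2 ^ n
  let E : ℕ → Set (CadlagPath d m) := fun n => {w | ∃ k, Z (t n k) w ∈ W}
  have hE : ∀ n, δ * P p (E n) ≤ P p H := fun n => by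
    let A : ℕ → Set (CadlagPath d m) := fun k => {w | Z (t n k) w ∈ W ∧ ∀ j < k, Z (t n j) w ∉ W}
    have hA : ∀ k, MeasurableSet[filt d m (t n k)] (A k) := fun k => by
      refine MeasurableSet.inter (measurable_Z_filt le_rfl hW.measurableSet) ?_
      change MeasurableSet[filt d m (t n k)] {w | ∀ j < k, Z (t n j) w ∉ W}
      simp_rw [ofPred_forall]
      refine MeasurableSet.iInter fun j => MeasurableSet.iInter fun hj => ?_
      exact measurable_Z_filt (by simp only [t]; gcongr) hW.measurableSet.compl
    have hAm : ∀ k, MeasurableSet (A k) := fun k => (filt d m).le _ _ (hA k)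
    have hdisj : Pairwise (Function.onFun Disjoint A) := by
      refine (pairwise_disjoint_on A).2 fun j k hjk => Set.disjoint_left.2 fun w hw hw' => ?_
      exact hw'.2 j hjk hw.1
    have hEA : E n = ⋃ k, A k := by
      ext w
      simp only [mem_iUnion]
      refine ⟨fun hw => ?_, fun ⟨k, hk⟩ => ⟨k, hk.1⟩⟩
      classical
      exact ⟨Nat.find hw, Nat.find_spec hw, fun j hj => Nat.find_min hw hj⟩
    have hshift : ∀ k, MeasurableSet (shift (t n k) ⁻¹' H) := fun k => by
      have : shift (t n k) ⁻¹' H = ⋃ q : ℚ, Z (t n k + Real.toNNReal q) ⁻¹' V := by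
        ext w
        simp only [mem_iUnion]
        exact exists_mem_iff_rat (shift (t n k) w) hV
      rw [this]
      exact MeasurableSet.iUnion fun q => measurable_Z _ hV.measurableSet
    calc δ * P p (E n) = ∑' k, δ * P p (A k) := by
          rw [hEA, measure_iUnion hdisj hAm, ENNReal.tsum_mul_left]
      _ ≤ ∑' k, P p (A k ∩ shift (t n k) ⁻¹' H) := by
          refine ENNReal.tsum_le_tsum fun k => ?_
          have := hP.markov p (t n k) (hA k) hHm
          calc δ * P p (A k) = ∫⁻ _ in A k, δ ∂(P p) := by simp
            _ ≤ ∫⁻ w in A k, P (Z (t n k) w) H ∂(P p) :=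
                setLIntegral_mono' (hAm k) fun w hw => h _ hw.1
            _ = _ := this.symm
      _ = P p (⋃ k, A k ∩ shift (t n k) ⁻¹' H) :=
          (measure_iUnion (fun j k hjk => (hdisj hjk).mono inter_subset_left inter_subset_left)
            fun k => (hAm k).inter (hshift k)).symm
      _ ≤ P p H := measure_mono (iUnion_subset fun k w hw => by
          obtain ⟨s, hs⟩ := hw.2
          exact ⟨_, hs⟩)
  have hmono : Monotone E := by
    refine monotone_nat_of_le_succ fun n w => ?_
    rintro ⟨k, hk⟩
    refine ⟨k * 2, ?_⟩
    have : t (n + 1) (k * 2) = t n k := by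
      simp only [t, pow_succ, Nat.cast_mul, Nat.cast_ofNat]
      exact mul_div_mul_right _ _ two_ne_zero
    rwa [this]
  have hUnion : ⋃ n, E n = {w | ∃ t, Z t w ∈ W} := by
    ext w
    simp only [mem_iUnion]
    refine ⟨fun ⟨n, k, hk⟩ => ⟨_, hk⟩, fun ⟨s, hs⟩ => ?_⟩
    obtain ⟨u, hu, hsu⟩ := w.exists_stay hW hs
    obtain ⟨n, hn⟩ := exists_pow_lt_of_lt_one (tsub_pos_of_lt hu)
      (show (1 / 2 : ℝ≥0) < 1 from NNReal.half_lt_self one_ne_zero)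
    have h2 : (0 : ℝ≥0) < 2 ^ n := by positivity
    refine ⟨n, ⌈s * 2 ^ n⌉₊, hsu _ ⟨?_, ?_⟩⟩
    · rw [le_div_iff₀ h2]
      exact Nat.le_ceil _
    · rw [div_lt_iff₀ h2]
      refine (Nat.ceil_lt_add_one zero_le).trans_le ?_
      have h3 : s + (1 / 2) ^ n ≤ u := (lt_tsub_iff_left.1 hn).le
      calc s * 2 ^ n + 1 = (s + (1 / 2) ^ n) * 2 ^ n := by
            rw [add_mul, ← mul_pow]; simp
        _ ≤ _ := by gcongr
  have hlim : Tendsto (fun n => δ * P p (E n)) atTop (𝓝 (δ * 1)) := by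
    rw [← hp, ← hUnion]
    exact ENNReal.Tendsto.const_mul (tendsto_measure_iUnion_atTop hmono)
      (Or.inl (by rw [hUnion, hp]; simp))
  rw [mul_one] at hlim
  exact le_of_tendsto' hlim hE

end

section

namespace CadlagPath

variable {d m : ℕ}

/-- The minimum of `T` and of the first time at which the path is in `V`. -/
noncomputable def hitMin (V : Set (State d m)) (T : ℝ≥0) (w : CadlagPath d m) : ℝ≥0 :=
  sInf (insert T {t | t ≤ T ∧ Z t w ∈ V})

/-- The index of the first point of the grid `(n + 1)⁻¹ ℕ ∩ [0, T]` at which the path is in `V`,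
or that of `T` if there is none. -/
noncomputable def gridHit (V : Set (State d m)) (T n : ℕ) : CadlagPath d m → ℕ :=
  hittingBtwn (fun k w => Z ((k : ℝ≥0) / (n + 1)) w) V 0 (T * (n + 1))

variable {V : Set (State d m)} {T : ℕ}

theorem gridHit_le (n : ℕ) (w : CadlagPath d m) : gridHit V T n w ≤ T * (n + 1) :=
  hittingBtwn_le w

theorem gridHit_div_le (n : ℕ) (w : CadlagPath d m) :
    (gridHit V T n w : ℝ≥0) / (n + 1) ≤ T := by
  rw [div_le_iff₀ (by positivity)]
  exact_mod_cast gridHit_le n w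

theorem gridHit_eq_or_mem (n : ℕ) (w : CadlagPath d m) :
    (gridHit V T n w : ℝ≥0) / (n + 1) = T ∨ Z ((gridHit V T n w : ℝ≥0) / (n + 1)) w ∈ V := by
  rcases (gridHit_le (V := V) (T := T) n w).eq_or_lt with h | h
  · left
    rw [h, div_eq_iff (by positivity)]
    push_cast
    rfl
  · right
    exact hittingBtwn_mem_set_of_hittingBtwn_lt h

theorem notMem_of_lt_hitMin {w : CadlagPath d m} {s : ℝ≥0} (hs : s < hitMin V T w) :
    Z s w ∉ V := fun h => by
  have hT : hitMin V T w ≤ T := csInf_le (OrderBot.bddBelow _) (mem_insert _ _)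
  exact hs.not_ge (csInf_le (OrderBot.bddBelow _) (mem_insert_of_mem _ ⟨hs.le.trans hT, h⟩))

theorem hitMin_le_gridHit (n : ℕ) (w : CadlagPath d m) :
    hitMin V T w ≤ (gridHit V T n w : ℝ≥0) / (n + 1) := by
  refine csInf_le (OrderBot.bddBelow _) ?_
  rcases gridHit_eq_or_mem (V := V) (T := T) n w with h | h
  · rw [h]
    exact mem_insert _ _
  · exact mem_insert_of_mem _ ⟨gridHit_div_le n w, h⟩

theorem tendsto_gridHit (hV : IsOpen V) (w : CadlagPath d m) :
    Tendsto (fun n : ℕ => (gridHit V T n w : ℝ≥0) / (n + 1)) atTop (𝓝 (hitMin V T w)) := by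
  refine tendsto_order.2 ⟨fun a ha => .of_forall fun n => ha.trans_le (hitMin_le_gridHit n w),
    fun b hb => ?_⟩
  obtain ⟨t, ht, htb⟩ := exists_lt_of_csInf_lt (insert_nonempty _ _) hb
  rcases eq_or_ne t T with rfl | htT
  · exact .of_forall fun n => (gridHit_div_le n w).trans_lt htb
  obtain ⟨htT', htV⟩ := (mem_insert_iff.1 ht).resolve_left htT
  obtain ⟨u, hu, hstay⟩ := w.exists_stay hV htV
  have hlt : t < min u (min b T) := lt_min hu (lt_min htb (lt_of_le_of_ne htT' htT))
  have hlim : Tendsto (fun n : ℕ => t + 1 / ((n : ℝ≥0) + 1)) atTop (𝓝 t) := by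
    simpa using (tendsto_one_div_add_atTop_nhds_zero_nat (𝕜 := ℝ≥0)).const_add t
  filter_upwards [hlim.eventually (gt_mem_nhds hlt)] with n hn
  have hpos : (0 : ℝ≥0) < n + 1 := by positivity
  have h1 : t ≤ (⌈t * (n + 1)⌉₊ : ℝ≥0) / (n + 1) := by
    rw [le_div_iff₀ hpos]
    exact Nat.le_ceil _
  have h2 : (⌈t * (n + 1)⌉₊ : ℝ≥0) / (n + 1) < min u (min b T) := by
    refine lt_of_le_of_lt ?_ hn
    rw [div_le_iff₀ hpos, add_mul, div_mul_cancel₀ _ hpos.ne']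
    exact (Nat.ceil_lt_add_one zero_le).le
  have h3 : ⌈t * (n + 1)⌉₊ ≤ T * (n + 1) := by
    have := (h2.trans_le ((min_le_right _ _).trans (min_le_right _ _))).le
    rw [div_le_iff₀ hpos] at this
    exact_mod_cast this
  have h4 : gridHit V T n w ≤ ⌈t * (n + 1)⌉₊ :=
    hittingBtwn_le_of_mem (Nat.zero_le _) h3 (hstay _ ⟨h1, h2.trans_le (min_le_left _ _)⟩)
  calc (gridHit V T n w : ℝ≥0) / (n + 1) ≤ (⌈t * (n + 1)⌉₊ : ℝ≥0) / (n + 1) := by gcongr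
    _ < b := h2.trans_le ((min_le_right _ _).trans (min_le_left _ _))

/-- The filtration of the canonical process observed on the grid `(n + 1)⁻¹ ℕ`. -/
noncomputable def gridFilt (d m n : ℕ) :
    Filtration ℕ (instMeasurableSpace (d := d) (m := m)) where
  seq k := filt d m ((k : ℝ≥0) / (n + 1))
  mono' j k hjk := (filt d m).mono (by gcongr)
  le' k := (filt d m).le _

theorem isStoppingTime_gridHit (hV : IsOpen V) (n : ℕ) :
    IsStoppingTime (gridFilt d m n) fun w => (gridHit V T n w : WithTop ℕ) := by
  refine Adapted.isStoppingTime_hittingBtwn ?_ hV.measurableSet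
  exact fun k => measurable_Z_filt le_rfl

theorem measurable_gridHit (hV : IsOpen V) (n : ℕ) :
    Measurable (gridHit (d := d) (m := m) V T n) := by
  refine measurable_of_Iic fun k => ?_
  have := (gridFilt d m n).le k _ (isStoppingTime_gridHit (T := T) hV n k)
  exact this.congr (by ext w; simp)

end CadlagPath

open CadlagPath

theorem le_intervalIntegral_of_le {g : ℝ → ℝ} {a b c K : ℝ} (hb : 0 ≤ b) (hba : b ≤ a)
    (hg : IntervalIntegrable g volume 0 a) (h1 : ∀ s ∈ Ioo 0 b, c ≤ g s) (h2 : ∀ s, -K ≤ g s) :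
    c * b - K * (a - b) ≤ ∫ s in (0 : ℝ)..a, g s := by
  have hg1 : IntervalIntegrable g volume 0 b :=
    hg.mono_set (by rw [uIcc_of_le hb, uIcc_of_le (hb.trans hba)]; exact Icc_subset_Icc_right hba)
  have hg2 : IntervalIntegrable g volume b a :=
    hg.mono_set (by rw [uIcc_of_le hba, uIcc_of_le (hb.trans hba)]; exact Icc_subset_Icc_left hb)
  rw [← intervalIntegral.integral_add_adjacent_intervals hg1 hg2]
  have e1 : ∫ _ in (0 : ℝ)..b, c ≤ ∫ s in (0 : ℝ)..b, g s :=
    intervalIntegral.integral_mono_on_of_le_Ioo hb intervalIntegrable_const hg1 h1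
  have e2 : ∫ _ in b..a, -K ≤ ∫ s in b..a, g s :=
    intervalIntegral.integral_mono_on hba intervalIntegrable_const hg2 fun s _ => h2 s
  simp only [intervalIntegral.integral_const, smul_eq_mul] at e1 e2
  linarith

variable {d m : ℕ}

/-- A measurable function of the state that is bounded on bounded sets is integrable along paths. -/
theorem CadlagPath.intervalIntegrable_comp {g : State d m → ℝ} (hg : Measurable g)
    (hb : ∀ N : ℝ, ∃ K, ∀ p, ‖p.1‖ ≤ N → |g p| ≤ K) (w : CadlagPath d m) (T : ℝ≥0) :
    IntervalIntegrable (fun s : ℝ => g (Z s.toNNReal w)) volume 0 T := by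
  obtain ⟨N, hN⟩ := w.exists_norm_le T
  obtain ⟨K, hK⟩ := hb N
  rw [intervalIntegrable_iff_integrableOn_Ioc_of_le (NNReal.coe_nonneg T)]
  refine Integrable.of_bound (C := K)
    (hg.comp (w.measurable_path.comp measurable_real_toNNReal)).aestronglyMeasurable ?_
  refine (ae_restrict_iff' measurableSet_Ioc).2 (.of_forall fun s hs => hK _ (hN _ ?_))
  exact Real.toNNReal_le_iff_le_coe.2 hs.2

/-- Lower bound for the probability of visiting `U`, from a function `f` that grows in mean until
the process enters `V ⊇ U`, and which is small on `V \ U`. -/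
theorem SolvesMartingaleProblem.le_prob_exists_mem {C : Coeff d m} {x : Rd d} {i : Fin m}
    {μ : Measure (CadlagPath d m)} (hμ : SolvesMartingaleProblem C x i μ) {f : Rd d → Fin m → ℝ}
    (hf : IsCb2 f) (hGm : Measurable fun p : State d m => C.G f p.1 p.2)
    (hGb : ∀ N : ℝ, ∃ K, ∀ p : State d m, ‖p.1‖ ≤ N → |C.G f p.1 p.2| ≤ K)
    {U V : Set (State d m)} (hU : IsOpen U) (hV : IsOpen V) {B ε c K : ℝ} (hc : 0 < c)
    (hB : 0 ≤ B) (hε : 0 ≤ ε)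
    (hfB : ∀ y j, f y j ≤ B) (hfε : ∀ p : State d m, p ∈ V → p ∉ U → f p.1 p.2 ≤ ε)
    (hGc : ∀ p : State d m, p ∉ V → c ≤ C.G f p.1 p.2)
    (hGK : ∀ p : State d m, -K ≤ C.G f p.1 p.2) :
    f x i ≤ ε + B * μ.real {w | ∃ t, Z t w ∈ U} := by
  have := hμ.prob
  set H : Set (CadlagPath d m) := {w | ∃ t, Z t w ∈ U} with hH
  have hHm : MeasurableSet H := measurableSet_exists_mem hU
  obtain ⟨T, hT⟩ : ∃ T : ℕ, B ≤ c * T := by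
    obtain ⟨T, hT⟩ := exists_nat_ge (B / c)
    exact ⟨T, by rwa [div_le_iff₀' hc] at hT⟩
  set M : ℝ≥0 → CadlagPath d m → ℝ := fun t w => f (X t w) (Λ t w) - f x i -
    ∫ s in (0 : ℝ)..(t : ℝ), C.G f (X s.toNNReal w) (Λ s.toNNReal w) with hM
  have hmart : Martingale M (filt d m) μ := hμ.martingale f hf
  let gap : ℕ → CadlagPath d m → ℝ := fun n w =>
    (((gridHit V T n w : ℝ≥0) / (n + 1) : ℝ≥0) : ℝ) - (hitMin V T w : ℝ)
  have hgap0 : ∀ n w, 0 ≤ gap n w := fun n w =>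
    sub_nonneg.2 (NNReal.coe_le_coe.2 (hitMin_le_gridHit n w))
  have hgapT : ∀ n w, gap n w ≤ T := fun n w => by
    have h1 : (((gridHit V T n w : ℝ≥0) / (n + 1) : ℝ≥0) : ℝ) ≤ ((T : ℝ≥0) : ℝ) :=
      NNReal.coe_le_coe.2 (gridHit_div_le n w)
    have h2 : (0 : ℝ) ≤ (hitMin V T w : ℝ) := NNReal.coe_nonneg _
    simp only [NNReal.coe_natCast] at h1
    linarith
  have hgapm : ∀ n, Measurable (gap n) := fun n => by
    have h1 : ∀ n : ℕ, Measurable fun w : CadlagPath d m => (gridHit V T n w : ℝ≥0) / (n + 1) :=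
      fun n => (measurable_from_nat (f := fun k : ℕ => (k : ℝ≥0) / (n + 1))).comp
        (measurable_gridHit hV n)
    have h2 : Measurable (hitMin (d := d) (m := m) V T) :=
      measurable_of_tendsto_metrizable h1 (tendsto_pi_nhds.2 fun w => tendsto_gridHit hV w)
    exact (h1 n).coe_nnreal_real.sub h2.coe_nnreal_real
  have hgapi : ∀ n, Integrable (gap n) μ := fun n =>
    Integrable.of_bound (hgapm n).aestronglyMeasurable (C := T) (.of_forall fun w => by
      rw [Real.norm_of_nonneg (hgap0 n w)]; exact hgapT n w)
  have hgaplim : Tendsto (fun n => ∫ w, gap n w ∂μ) atTop (𝓝 0) := by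
    have := tendsto_integral_of_dominated_convergence (μ := μ) (F := gap) (f := fun _ => (0 : ℝ))
      (fun _ => (T : ℝ)) (fun n => (hgapm n).aestronglyMeasurable) (integrable_const _)
      (fun n => .of_forall fun w => by
        rw [Real.norm_of_nonneg (hgap0 n w)]; exact hgapT n w)
      (.of_forall fun w => by
        have := (NNReal.tendsto_coe.2 (tendsto_gridHit (T := T) hV w)).sub_const
          (hitMin V T w : ℝ)
        simpa [gap] using this)
    simpa using this
  have hpath : ∀ n w, M ((gridHit V T n w : ℝ≥0) / (n + 1)) w ≤
      H.indicator (fun _ => B) w + (ε - f x i) + (c + K) * gap n w := fun n w => by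
    set a : ℝ≥0 := (gridHit V T n w : ℝ≥0) / (n + 1) with ha
    have hint : c * hitMin V T w - K * (a - hitMin V T w) ≤
        ∫ s in (0 : ℝ)..(a : ℝ), C.G f (X s.toNNReal w) (Λ s.toNNReal w) := by
      refine le_intervalIntegral_of_le (NNReal.coe_nonneg _)
        (NNReal.coe_le_coe.2 (hitMin_le_gridHit n w))
        (intervalIntegrable_comp (g := fun p => C.G f p.1 p.2) hGm hGb w a)
        (fun s hs => hGc (Z s.toNNReal w) (notMem_of_lt_hitMin (T := T) ?_)) fun s => hGK _
      exact (Real.toNNReal_lt_iff_lt_coe hs.1.le).2 hs.2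
    have hval : f (X a w) (Λ a w) - c * a ≤ H.indicator (fun _ => B) w + ε := by
      have hi0 : 0 ≤ H.indicator (fun _ => B) w := indicator_nonneg (fun _ _ => hB) w
      have ha0 : 0 ≤ c * (a : ℝ) := mul_nonneg hc.le (NNReal.coe_nonneg _)
      rcases gridHit_eq_or_mem (V := V) (T := T) n w with h | h
      · rw [← ha] at h
        have h5 : (a : ℝ) = T := by rw [h]; simp
        rw [h5]
        linarith [hfB (X a w) (Λ a w)]
      · rw [← ha] at h
        by_cases hu : Z a w ∈ U
        · rw [indicator_of_mem (show w ∈ H from ⟨a, hu⟩)]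
          linarith [hfB (X a w) (Λ a w)]
        · have h6 : f (X a w) (Λ a w) ≤ ε := hfε (Z a w) h hu
          linarith
    have hg : gap n w = a - hitMin V T w := rfl
    have hMa : M a w = f (X a w) (Λ a w) - f x i -
      ∫ s in (0 : ℝ)..(a : ℝ), C.G f (X s.toNNReal w) (Λ s.toNNReal w) := rfl
    rw [hMa, hg]
    linarith
  have hexp : ∀ n, 0 ≤ B * μ.real H + (ε - f x i) + (c + K) * ∫ w, gap n w ∂μ := fun n => by
    have hsub : Submartingale (fun (k : ℕ) w => M ((k : ℝ≥0) / (n + 1)) w) (gridFilt d m n) μ := by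
      refine Martingale.submartingale ⟨fun k => hmart.1 _, fun j k hjk => ?_⟩
      exact hmart.2 _ _ (by gcongr)
    have hst := isStoppingTime_gridHit (T := T) hV n
    have hbd : ∀ w, (gridHit V T n w : WithTop ℕ) ≤ ((T * (n + 1) : ℕ) : WithTop ℕ) :=
      fun w => WithTop.coe_le_coe.2 (gridHit_le n w)
    have hopt := hsub.expected_stoppedValue_mono (isStoppingTime_const _ 0) hst
      (fun w => WithTop.coe_le_coe.2 (Nat.zero_le _)) hbd
    have hsi := hsub.integrable_stoppedValue hst hbd
    have h0 : ∀ᵐ w ∂μ, M ((0 : ℕ) / (n + 1)) w = 0 := by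
      have hinit : ∀ᵐ w ∂μ, w ∈ {w | X 0 w = x ∧ Λ 0 w = i} := by
        refine (mem_ae_iff_prob_eq_one ?_).2 hμ.init
        exact measurable_Z 0 (measurableSet_singleton (x, i))|>.congr <| by
          ext w
          simp [X, Λ, Prod.ext_iff]
      filter_upwards [hinit] with w hw
      obtain ⟨h1, h2⟩ := hw
      simp [M, h1, h2]
    have hz : ∫ w, stoppedValue (fun (k : ℕ) w => M ((k : ℝ≥0) / (n + 1)) w)
        (fun _ => ((0 : ℕ) : WithTop ℕ)) w ∂μ = 0 := by
      change ∫ w, M ((0 : ℕ) / (n + 1)) w ∂μ = 0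
      rw [integral_congr_ae h0]
      simp
    have hbound := integral_mono (μ := μ) hsi
      (((integrable_const B).indicator hHm).add (integrable_const (ε - f x i)) |>.add
        ((hgapi n).const_mul (c + K))) fun w => hpath n w
    have hcalc : ∫ w, (H.indicator (fun _ => B) + (fun _ => ε - f x i) +
        (fun w => (c + K) * gap n w) : CadlagPath d m → ℝ) w ∂μ =
        B * μ.real H + (ε - f x i) + (c + K) * ∫ w, gap n w ∂μ := by
      rw [integral_add' (((integrable_const B).indicator hHm).add (integrable_const _))
        ((hgapi n).const_mul _), integral_add' ((integrable_const B).indicator hHm)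
        (integrable_const _), integral_indicator_const _ hHm, integral_const_mul]
      simp [mul_comm]
    rw [hcalc] at hbound
    exact (hz.symm.le.trans hopt).trans hbound
  have hlim : Tendsto (fun n => B * μ.real H + (ε - f x i) + (c + K) * ∫ w, gap n w ∂μ) atTop
      (𝓝 (B * μ.real H + (ε - f x i) + (c + K) * 0)) := (hgaplim.const_mul _).const_add _
  have := ge_of_tendsto' hlim hexp
  linarith

end

section

variable {d m : ℕ}

/-- The unnormalised Gaussian `exp (-lam |y - x₀|²)`. -/
noncomputable def gaussBump (lam : ℝ) (x₀ y : Rd d) : ℝ := Real.exp (-lam * ‖y - x₀‖ ^ 2)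

section gaussBump

variable (lam : ℝ) (x₀ : Rd d)

theorem gaussBump_pos (y : Rd d) : 0 < gaussBump lam x₀ y := Real.exp_pos _

theorem contDiff_gaussBump : ContDiff ℝ 2 (gaussBump lam x₀) :=
  (contDiff_const.mul ((contDiff_id.sub contDiff_const).norm_sq ℝ)).exp

theorem hasFDerivAt_gaussBump (y : Rd d) :
    HasFDerivAt (gaussBump lam x₀) ((-(2 * lam) * gaussBump lam x₀ y) • innerSL ℝ (y - x₀)) y := by
  have h := ((((hasFDerivAt_id y).sub_const x₀).norm_sq).const_mul (-lam)).exp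
  convert! h using 1
  ext z
  simp [gaussBump]
  ring

theorem fderiv_gaussBump :
    fderiv ℝ (gaussBump lam x₀) =
      fun y => (-(2 * lam) * gaussBump lam x₀ y) • innerSL ℝ (y - x₀) :=
  funext fun y => (hasFDerivAt_gaussBump lam x₀ y).fderiv

theorem fderiv_gaussBump_apply (y z : Rd d) :
    fderiv ℝ (gaussBump lam x₀) y z = gaussBump lam x₀ y * (-(2 * lam) * inner ℝ (y - x₀) z) := by
  simp [fderiv_gaussBump, inner_sub_left]
  ring

theorem fderiv_fderiv_gaussBump_apply (y h k : Rd d) :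
    fderiv ℝ (fderiv ℝ (gaussBump lam x₀)) y h k = gaussBump lam x₀ y *
      (4 * lam ^ 2 * inner ℝ (y - x₀) h * inner ℝ (y - x₀) k - 2 * lam * inner ℝ h k) := by
  have h1 := ((hasFDerivAt_gaussBump lam x₀ y).const_mul (-(2 * lam))).smul
    ((innerSL ℝ (E := Rd d)).hasFDerivAt.comp y ((hasFDerivAt_id y).sub_const x₀))
  rw [fderiv_gaussBump]
  refine (congrArg (fun L : Rd d →L[ℝ] Rd d →L[ℝ] ℝ => L h k) h1.fderiv).trans ?_
  change -(2 * lam) * gaussBump lam x₀ y * inner ℝ h k +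
    -(2 * lam) * (-(2 * lam) * gaussBump lam x₀ y * inner ℝ (y - x₀) h) * inner ℝ (y - x₀) k = _
  ring

theorem iteratedFDeriv_two_gaussBump (y h k : Rd d) :
    iteratedFDeriv ℝ 2 (gaussBump lam x₀) y ![h, k] = gaussBump lam x₀ y *
      (4 * lam ^ 2 * inner ℝ (y - x₀) h * inner ℝ (y - x₀) k - 2 * lam * inner ℝ h k) := by
  rw [iteratedFDeriv_two_apply]
  exact fderiv_fderiv_gaussBump_apply lam x₀ y h k

variable {lam}

theorem gaussBump_le_one (hlam : 0 ≤ lam) (y : Rd d) : gaussBump lam x₀ y ≤ 1 :=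
  Real.exp_le_one_iff.2 (by nlinarith [sq_nonneg ‖y - x₀‖, mul_nonneg hlam (sq_nonneg ‖y - x₀‖)])

theorem mul_gaussBump_le (y : Rd d) :
    lam * ‖y - x₀‖ ^ 2 * gaussBump lam x₀ y ≤ 1 := by
  have h := Real.add_one_le_exp (lam * ‖y - x₀‖ ^ 2)
  have h2 : gaussBump lam x₀ y * Real.exp (lam * ‖y - x₀‖ ^ 2) = 1 := by
    rw [gaussBump, ← Real.exp_add]; simp
  nlinarith [gaussBump_pos lam x₀ y]

theorem norm_sq_mul_gaussBump_le (hlam : 1 ≤ lam) (y : Rd d) :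
    (1 + ‖y - x₀‖ ^ 2) * gaussBump lam x₀ y ≤ 2 := by
  have h1 := gaussBump_le_one x₀ (zero_le_one.trans hlam) y
  have h2 := mul_gaussBump_le (lam := lam) x₀ y
  have h3 := gaussBump_pos lam x₀ y
  have h4 : ‖y - x₀‖ ^ 2 * gaussBump lam x₀ y ≤ lam * (‖y - x₀‖ ^ 2 * gaussBump lam x₀ y) :=
    le_mul_of_one_le_left (by positivity) hlam
  linarith

theorem isCb2_mul_gaussBump (hlam : 1 ≤ lam) (c : Fin m → ℝ) :
    IsCb2 fun (y : Rd d) j => c j * gaussBump lam x₀ y := by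
  intro j
  have hl0 : 0 ≤ lam := zero_le_one.trans hlam
  have hcd := contDiff_gaussBump lam x₀
  refine ⟨contDiff_const.mul hcd, |c j| * (8 * lam ^ 2 + 4 * lam + 1), fun y => ?_⟩
  have hb := norm_sq_mul_gaussBump_le x₀ hlam y
  have h0 := gaussBump_pos lam x₀ y
  have h1 := gaussBump_le_one x₀ hl0 y
  have hn := norm_nonneg (y - x₀)
  refine ⟨?_, ?_, ?_⟩
  · rw [abs_mul, abs_of_pos h0]
    gcongr
    nlinarith
  · have : fderiv ℝ (fun y => c j * gaussBump lam x₀ y) y = c j • fderiv ℝ (gaussBump lam x₀) y :=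
      fderiv_const_mul (hcd.differentiable two_ne_zero y) _
    rw [this, norm_smul, Real.norm_eq_abs]
    gcongr
    rw [fderiv_gaussBump, norm_smul, innerSL_apply_norm, norm_mul, Real.norm_of_nonneg h0.le,
      norm_neg, Real.norm_of_nonneg (by positivity)]
    have h5 : gaussBump lam x₀ y * ‖y - x₀‖ ≤ 2 := by nlinarith [sq_nonneg (‖y - x₀‖ - 1)]
    nlinarith
  · have : iteratedFDeriv ℝ 2 (fun y => c j * gaussBump lam x₀ y) y =
        c j • iteratedFDeriv ℝ 2 (gaussBump lam x₀) y :=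
      iteratedFDeriv_const_smul_apply (a := c j) hcd.contDiffAt
    rw [this, norm_smul, Real.norm_eq_abs]
    gcongr
    refine ContinuousMultilinearMap.opNorm_le_bound (by positivity) fun v => ?_
    have hv : iteratedFDeriv ℝ 2 (gaussBump lam x₀) y v =
        iteratedFDeriv ℝ 2 (gaussBump lam x₀) y ![v 0, v 1] := by
      congr 1
      ext k
      fin_cases k <;> rfl
    rw [hv, iteratedFDeriv_two_gaussBump, Fin.prod_univ_two, norm_mul, Real.norm_of_nonneg h0.le]
    have e1 := abs_real_inner_le_norm (y - x₀) (v 0)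
    have e2 := abs_real_inner_le_norm (y - x₀) (v 1)
    have e3 := abs_real_inner_le_norm (v 0) (v 1)
    set N := ‖v 0‖ * ‖v 1‖ with hN
    have hN0 : 0 ≤ N := by positivity
    calc gaussBump lam x₀ y * ‖4 * lam ^ 2 * inner ℝ (y - x₀) (v 0) * inner ℝ (y - x₀) (v 1)
          - 2 * lam * inner ℝ (v 0) (v 1)‖
        ≤ gaussBump lam x₀ y * (4 * lam ^ 2 * ‖y - x₀‖ ^ 2 * N + 2 * lam * N) := by
          gcongr
          refine (norm_sub_le _ _).trans (add_le_add ?_ ?_)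
          · rw [norm_mul, norm_mul, Real.norm_of_nonneg (by positivity), Real.norm_eq_abs,
              Real.norm_eq_abs]
            calc _ ≤ 4 * lam ^ 2 * (‖y - x₀‖ * ‖v 0‖) * (‖y - x₀‖ * ‖v 1‖) := by gcongr
              _ = _ := by rw [hN]; ring
          · rw [norm_mul, Real.norm_of_nonneg (by positivity), Real.norm_eq_abs]
            gcongr
      _ = (4 * lam ^ 2 * (‖y - x₀‖ ^ 2 * gaussBump lam x₀ y) +
            2 * lam * gaussBump lam x₀ y) * N := by ring
      _ ≤ (4 * lam ^ 2 * 2 + 2 * lam * 1) * N := by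
          gcongr
          linarith
      _ ≤ _ := mul_le_mul_of_nonneg_right (by linarith) hN0

end gaussBump

end

namespace Coeff

variable {d m : ℕ} (C : Coeff d m)

/-- The jump part of the generator, applied to `gaussBump lam x₀`. -/
noncomputable def jumpGauss (lam : ℝ) (x₀ y : Rd d) (j : Fin m) : ℝ :=
  ∫ z, (gaussBump lam x₀ (y + z) - gaussBump lam x₀ y -
    (if ‖z‖ < 1 then fderiv ℝ (gaussBump lam x₀) y z else 0)) ∂(C.jump y j)

/-- The generator without its switching part, applied to `gaussBump lam x₀`. -/
noncomputable def localGauss (lam : ℝ) (x₀ y : Rd d) (j : Fin m) : ℝ :=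
  gaussBump lam x₀ y * (2 * lam ^ 2 * ∑ k, ∑ l, (y - x₀) k * C.a y j k l * (y - x₀) l
    - lam * (∑ k, C.a y j k k + 2 * ∑ k, C.b y j k * (y - x₀) k)) + C.jumpGauss lam x₀ y j

/-- `∫ (1 ∧ |z|²) π_j(y,dz)`. -/
noncomputable def levyMass (y : Rd d) (j : Fin m) : ℝ := ∫ z, min 1 (‖z‖ ^ 2) ∂(C.jump y j)

theorem G_mul_gaussBump (lam : ℝ) (x₀ : Rd d) (c : Fin m → ℝ) (y : Rd d) (j : Fin m) :
    C.G (fun y j => c j * gaussBump lam x₀ y) y j =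
      c j * C.localGauss lam x₀ y j + (∑ k, C.q y j k * c k) * gaussBump lam x₀ y := by
  have hcd := contDiff_gaussBump lam x₀
  have hf1 : fderiv ℝ (fun y => c j * gaussBump lam x₀ y) y =
      c j • fderiv ℝ (gaussBump lam x₀) y :=
    fderiv_const_mul (hcd.differentiable two_ne_zero y) _
  have hf2 : iteratedFDeriv ℝ 2 (fun y => c j * gaussBump lam x₀ y) y =
      c j • iteratedFDeriv ℝ 2 (gaussBump lam x₀) y :=
    iteratedFDeriv_const_smul_apply (a := c j) hcd.contDiffAt
  have hJ : ∫ z, (c j * gaussBump lam x₀ (y + z) - c j * gaussBump lam x₀ y -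
      (if ‖z‖ < 1 then (c j • fderiv ℝ (gaussBump lam x₀) y) z else 0)) ∂(C.jump y j) =
      c j * C.jumpGauss lam x₀ y j := by
    rw [jumpGauss, ← integral_const_mul]
    refine integral_congr_ae (.of_forall fun z => ?_)
    simp only
    split_ifs
    · simp only [_root_.smul_apply, smul_eq_mul]
      ring
    · ring
  have hQ : ∑ k, C.q y j k * (c k * gaussBump lam x₀ y) =
      (∑ k, C.q y j k * c k) * gaussBump lam x₀ y := by
    rw [Finset.sum_mul]
    exact Finset.sum_congr rfl fun k _ => by ring
  have hB : ∑ k, C.b y j k * (c j • fderiv ℝ (gaussBump lam x₀) y) (EuclideanSpace.single k (1 : ℝ))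
      = -(c j * gaussBump lam x₀ y * (lam * (2 * ∑ k, C.b y j k * (y - x₀) k))) := by
    rw [Finset.mul_sum, Finset.mul_sum, Finset.mul_sum, ← Finset.sum_neg_distrib]
    refine Finset.sum_congr rfl fun k _ => ?_
    rw [_root_.smul_apply, fderiv_gaussBump_apply, EuclideanSpace.inner_single_right]
    simp only [smul_eq_mul, conj_trivial]
    ring
  have hA : ∑ k, ∑ l, C.a y j k l * (c j • iteratedFDeriv ℝ 2 (gaussBump lam x₀) y)
        ![EuclideanSpace.single k (1 : ℝ), EuclideanSpace.single l (1 : ℝ)] =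
      c j * gaussBump lam x₀ y * (4 * lam ^ 2 * ∑ k, ∑ l, (y - x₀) k * C.a y j k l * (y - x₀) l
        - 2 * lam * ∑ k, C.a y j k k) := by
    have hd : ∀ k, C.a y j k k = ∑ l, if k = l then C.a y j k l else 0 := fun k => by simp
    rw [Finset.sum_congr rfl fun k _ => hd k, Finset.mul_sum, Finset.mul_sum,
      ← Finset.sum_sub_distrib, Finset.mul_sum]
    refine Finset.sum_congr rfl fun k _ => ?_
    rw [Finset.mul_sum, Finset.mul_sum, ← Finset.sum_sub_distrib, Finset.mul_sum]
    refine Finset.sum_congr rfl fun l _ => ?_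
    rw [_root_.smul_apply, iteratedFDeriv_two_gaussBump, EuclideanSpace.inner_single_right,
      EuclideanSpace.inner_single_right, EuclideanSpace.inner_single_right]
    simp only [smul_eq_mul, conj_trivial]
    by_cases hkl : k = l
    · subst hkl
      simp
      ring
    · simp [hkl, Ne.symm hkl]
      ring
  simp only [G, hf1, hf2]
  rw [hJ, hQ, hA, hB, localGauss]
  ring

variable {C}

theorem integrable_min_one_sq (hC : C.Admissible) (y : Rd d) (j : Fin m) :
    Integrable (fun z => min 1 (‖z‖ ^ 2)) (C.jump y j) := by
  refine ⟨(by fun_prop : Measurable fun z : Rd d => min (1 : ℝ) (‖z‖ ^ 2)).aestronglyMeasurable, ?_⟩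
  rw [hasFiniteIntegral_iff_ofReal (.of_forall fun z => by positivity)]
  exact hC.levy y j

theorem levyMass_nonneg (y : Rd d) (j : Fin m) : 0 ≤ C.levyMass y j :=
  integral_nonneg fun z => by positivity

theorem exists_levyMass_le (hC : C.Admissible) :
    ∃ K, 0 ≤ K ∧ ∀ y j, C.levyMass y j ≤ K * (1 + ‖y‖ ^ 2) := by
  obtain ⟨c, hc, hsmall⟩ := hC.small_jumps
  obtain ⟨K, hK, hbig⟩ := hC.big_jumps
  refine ⟨c + K.toReal, by positivity, fun y j => ?_⟩
  have h1 : ∫⁻ z, ENNReal.ofReal (min 1 (‖z‖ ^ 2)) ∂(C.jump y j) ≤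
      ENNReal.ofReal (c * (1 + ‖y‖ ^ 2)) + K := by
    rw [← lintegral_add_compl _ (measurableSet_ball (x := (0 : Rd d)) (ε := 1))]
    refine add_le_add ((lintegral_mono fun z => ?_).trans (hsmall y j)) ?_
    · exact ENNReal.ofReal_le_ofReal (min_le_right _ _)
    · calc ∫⁻ z in (ball (0 : Rd d) 1)ᶜ, ENNReal.ofReal (min 1 (‖z‖ ^ 2)) ∂(C.jump y j)
          ≤ ∫⁻ _ in (ball (0 : Rd d) 1)ᶜ, 1 ∂(C.jump y j) := lintegral_mono fun z => by
            rw [ENNReal.ofReal_le_one]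
            exact min_le_left _ _
        _ ≤ K := by simpa using hbig y j
  rw [levyMass, integral_eq_lintegral_of_nonneg_ae (.of_forall fun z => by positivity)
    (integrable_min_one_sq hC y j).aestronglyMeasurable]
  refine (ENNReal.toReal_mono (by finiteness) h1).trans ?_
  rw [ENNReal.toReal_add (by finiteness) hK.ne, ENNReal.toReal_ofReal (by positivity)]
  nlinarith [sq_nonneg ‖y‖, ENNReal.toReal_nonneg (a := K),
    mul_nonneg (ENNReal.toReal_nonneg (a := K)) (sq_nonneg ‖y‖)]

theorem gaussBump_add (lam : ℝ) (x₀ y z : Rd d) :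
    gaussBump lam x₀ (y + z) =
      gaussBump lam x₀ y * Real.exp (-lam * (2 * inner ℝ (y - x₀) z + ‖z‖ ^ 2)) := by
  rw [gaussBump, gaussBump, ← Real.exp_add, add_sub_right_comm, norm_add_sq_real]
  ring_nf

/-- Pointwise lower bound for the integrand of the jump part. -/
theorem le_jump_integrand {lam : ℝ} (hlam : 1 ≤ lam) (x₀ y z : Rd d) :
    -(lam * gaussBump lam x₀ y) * min 1 (‖z‖ ^ 2) ≤
      gaussBump lam x₀ (y + z) - gaussBump lam x₀ y -
        (if ‖z‖ < 1 then fderiv ℝ (gaussBump lam x₀) y z else 0) := by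
  have h0 := gaussBump_pos lam x₀ y
  split_ifs with hz
  · rw [min_eq_right (by nlinarith [norm_nonneg z]), gaussBump_add, fderiv_gaussBump_apply]
    have := Real.add_one_le_exp (-lam * (2 * inner ℝ (y - x₀) z + ‖z‖ ^ 2))
    nlinarith
  · rw [min_eq_left (by nlinarith [norm_nonneg z])]
    have := gaussBump_pos lam x₀ (y + z)
    nlinarith

/-- Pointwise upper bound for the integrand of the jump part, uniform on bounded sets. -/
theorem abs_jump_integrand_le {lam : ℝ} (hlam : 1 ≤ lam) {N : ℝ} {x₀ y : Rd d}
    (hy : ‖y - x₀‖ ≤ N) (z : Rd d) :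
    |gaussBump lam x₀ (y + z) - gaussBump lam x₀ y -
        (if ‖z‖ < 1 then fderiv ℝ (gaussBump lam x₀) y z else 0)| ≤
      ((lam * (2 * N + 1)) ^ 2 * Real.exp (lam * (2 * N + 1)) + lam) * min 1 (‖z‖ ^ 2) := by
  have h0 := gaussBump_pos lam x₀ y
  have hl0 : 0 ≤ lam := zero_le_one.trans hlam
  have h1 := gaussBump_le_one x₀ hl0 y
  have hN : 0 ≤ N := (norm_nonneg _).trans hy
  split_ifs with hz
  · rw [min_eq_right (by nlinarith [norm_nonneg z]), gaussBump_add, fderiv_gaussBump_apply]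
    set u := -lam * (2 * inner ℝ (y - x₀) z + ‖z‖ ^ 2) with hu
    have hin := abs_real_inner_le_norm (y - x₀) z
    have hin2 : ‖y - x₀‖ * ‖z‖ ≤ N * ‖z‖ := by gcongr
    have huz : |u| ≤ lam * (2 * N + 1) * ‖z‖ := by
      rw [hu, abs_mul, abs_neg, abs_of_nonneg hl0, mul_assoc]
      gcongr
      refine (abs_add_le _ _).trans ?_
      rw [abs_mul, abs_of_pos (two_pos : (0 : ℝ) < 2), abs_of_nonneg (sq_nonneg ‖z‖)]
      nlinarith [norm_nonneg z]
    have hu1 : |u| ≤ lam * (2 * N + 1) :=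
      huz.trans (mul_le_of_le_one_right (by positivity) hz.le)
    have hexp : |Real.exp u - 1 - u| ≤ |u| ^ 2 * Real.exp |u| := by
      have := Complex.norm_exp_sub_sum_le_norm_mul_exp (u : ℂ) 2
      simp only [Finset.sum_range_succ, Finset.sum_range_zero, pow_zero, pow_one, zero_add,
        Nat.factorial_zero, Nat.factorial_one, Nat.cast_one, div_one, Complex.norm_real,
        Real.norm_eq_abs] at this
      rw [← Real.norm_eq_abs, ← Complex.norm_real]
      push_cast
      rwa [sub_sub]
    have hexp2 : |u| ^ 2 * Real.exp |u| ≤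
        (lam * (2 * N + 1) * ‖z‖) ^ 2 * Real.exp (lam * (2 * N + 1)) := by gcongr
    have heq : gaussBump lam x₀ y * Real.exp u - gaussBump lam x₀ y -
        gaussBump lam x₀ y * (-(2 * lam) * inner ℝ (y - x₀) z) =
        gaussBump lam x₀ y * ((Real.exp u - 1 - u) - lam * ‖z‖ ^ 2) := by
      rw [hu]; ring
    rw [heq, abs_mul, abs_of_pos h0]
    calc gaussBump lam x₀ y * |Real.exp u - 1 - u - lam * ‖z‖ ^ 2|
        ≤ 1 * |Real.exp u - 1 - u - lam * ‖z‖ ^ 2| := by gcongr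
      _ ≤ |Real.exp u - 1 - u| + |lam * ‖z‖ ^ 2| := by rw [one_mul]; exact abs_sub _ _
      _ ≤ (lam * (2 * N + 1) * ‖z‖) ^ 2 * Real.exp (lam * (2 * N + 1)) + lam * ‖z‖ ^ 2 := by
          rw [abs_of_nonneg (by positivity : 0 ≤ lam * ‖z‖ ^ 2)]
          gcongr
          exact hexp.trans hexp2
      _ = _ := by ring
  · rw [min_eq_left (by nlinarith [norm_nonneg z]), sub_zero, mul_one]
    have h2 := gaussBump_pos lam x₀ (y + z)
    have h3 := gaussBump_le_one x₀ hl0 (y + z)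
    have h4 : 0 ≤ (lam * (2 * N + 1)) ^ 2 * Real.exp (lam * (2 * N + 1)) := by positivity
    exact (abs_le.2 ⟨by linarith, by linarith⟩ : _ ≤ (1 : ℝ)).trans (by linarith)

theorem measurable_jump_integrand (lam : ℝ) (x₀ : Rd d) :
    Measurable fun p : Rd d × Rd d => gaussBump lam x₀ (p.1 + p.2) - gaussBump lam x₀ p.1 -
      (if ‖p.2‖ < 1 then fderiv ℝ (gaussBump lam x₀) p.1 p.2 else 0) := by
  have hc : Continuous (gaussBump lam x₀) := (contDiff_gaussBump lam x₀).continuous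
  simp only [fderiv_gaussBump_apply]
  refine ((hc.comp (by fun_prop)).measurable.sub (hc.comp continuous_fst).measurable).sub ?_
  refine Measurable.ite (measurableSet_lt (by fun_prop) measurable_const) ?_ measurable_const
  exact ((hc.comp continuous_fst).mul (by fun_prop)).measurable

theorem integrable_jump_integrand (hC : C.Admissible) {lam : ℝ} (hlam : 1 ≤ lam) (x₀ y : Rd d)
    (j : Fin m) :
    Integrable (fun z => gaussBump lam x₀ (y + z) - gaussBump lam x₀ y -
      (if ‖z‖ < 1 then fderiv ℝ (gaussBump lam x₀) y z else 0)) (C.jump y j) :=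
  ((integrable_min_one_sq hC y j).const_mul _).mono'
    ((measurable_jump_integrand lam x₀).comp measurable_prodMk_left).aestronglyMeasurable
    (.of_forall fun z => abs_jump_integrand_le hlam le_rfl z)

theorem le_jumpGauss (hC : C.Admissible) {lam : ℝ} (hlam : 1 ≤ lam) (x₀ y : Rd d) (j : Fin m) :
    -(lam * gaussBump lam x₀ y) * C.levyMass y j ≤ C.jumpGauss lam x₀ y j := by
  rw [levyMass, ← integral_const_mul]
  exact integral_mono ((integrable_min_one_sq hC y j).const_mul _)
    (integrable_jump_integrand hC hlam x₀ y j) fun z => le_jump_integrand hlam x₀ y z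

theorem abs_jumpGauss_le (hC : C.Admissible) {lam : ℝ} (hlam : 1 ≤ lam) {N : ℝ} {x₀ y : Rd d}
    (hy : ‖y - x₀‖ ≤ N) (j : Fin m) :
    |C.jumpGauss lam x₀ y j| ≤
      ((lam * (2 * N + 1)) ^ 2 * Real.exp (lam * (2 * N + 1)) + lam) * C.levyMass y j := by
  rw [levyMass, ← integral_const_mul, ← Real.norm_eq_abs, jumpGauss]
  exact norm_integral_le_of_norm_le ((integrable_min_one_sq hC y j).const_mul _)
    (.of_forall fun z => abs_jump_integrand_le hlam hy z)

theorem measurable_jumpGauss (hC : C.Admissible) (lam : ℝ) (x₀ : Rd d) (j : Fin m) :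
    Measurable fun y => C.jumpGauss lam x₀ y j := by
  have h : ∀ y, C.jumpGauss lam x₀ y j = ∫ z, C.pit y j z * (gaussBump lam x₀ (y + z) -
      gaussBump lam x₀ y - (if ‖z‖ < 1 then fderiv ℝ (gaussBump lam x₀) y z else 0)) := fun y => by
    have hm : Measurable fun z => ENNReal.ofReal (C.pit y j z) :=
      ((hC.pit_meas j).comp measurable_prodMk_left).ennreal_ofReal
    rw [jumpGauss, jump, integral_withDensity_eq_integral_toReal_smul hm (by simp)]
    simp only [ENNReal.toReal_ofReal (hC.pit_nonneg _ _ _), smul_eq_mul]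
  simp only [h]
  exact ((hC.pit_meas j).mul (measurable_jump_integrand lam x₀)).stronglyMeasurable
    |>.integral_prod_right' (f := fun p : Rd d × Rd d => C.pit p.1 j p.2 * _)|>.measurable

end Coeff

theorem bddDomain_ball {d : ℕ} (x₀ : Rd d) {r : ℝ} (hr : 0 < r) : BddDomain (ball x₀ r) :=
  ⟨isOpen_ball, (convex_ball x₀ r).isConnected (nonempty_ball.2 hr), isBounded_ball⟩

namespace Coeff

variable {d m : ℕ} {C : Coeff d m}

theorem quad_nonneg (hC : C.Admissible) (y ξ : Rd d) (j : Fin m) :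
    0 ≤ ∑ k, ∑ l, ξ k * C.a y j k l * ξ l := by
  obtain ⟨κ, hκ, h⟩ := hC.ellipticity _ (bddDomain_ball y one_pos)
  have := hκ.1
  exact le_trans (by positivity) (h y (mem_ball_self one_pos) j ξ).1

theorem abs_apply_le_norm (ξ : Rd d) (k : Fin d) : |ξ k| ≤ ‖ξ‖ := PiLp.norm_apply_le ξ k

theorem continuous_a (hC : C.Admissible) (j k l) : Continuous fun y => C.a y j k l :=
  ((hC.sig_cont j).matrix_mul (hC.sig_cont j).matrix_transpose).matrix_elem k l

/-- Quadratic growth of the coefficients that enter the lower bound for the generator. -/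
theorem exists_growth (hC : C.Admissible) (x₀ : Rd d) :
    ∃ K, 0 ≤ K ∧ ∀ y j, |∑ k, C.a y j k k + 2 * ∑ k, C.b y j k * (y - x₀) k| + C.levyMass y j ≤
      K * (1 + ‖y - x₀‖ ^ 2) := by
  obtain ⟨c, hc, hgrowth⟩ := hC.growth
  obtain ⟨L, hL, hlevy⟩ := exists_levyMass_le hC
  refine ⟨(c ^ 2 + c + L) * (2 * (1 + ‖x₀‖) ^ 2 + 1), by positivity, fun y j => ?_⟩
  set ρ := ‖y - x₀‖ with hρ
  set s := 1 + ‖y‖ with hs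
  have hs1 : 1 ≤ s := by rw [hs]; linarith [norm_nonneg y]
  have hρ0 : 0 ≤ ρ := norm_nonneg _
  have hsρ : s ≤ (1 + ‖x₀‖) + ρ := by
    have := norm_add_le (y - x₀) x₀
    rw [sub_add_cancel] at this
    linarith
  have hx0 := norm_nonneg x₀
  have hs2 : s ^ 2 ≤ 2 * (1 + ‖x₀‖) ^ 2 * (1 + ρ ^ 2) := by
    have h1 : s ^ 2 ≤ ((1 + ‖x₀‖) + ρ) ^ 2 := by gcongr
    have h2 : 1 ≤ (1 + ‖x₀‖) ^ 2 := by nlinarith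
    nlinarith [sq_nonneg ((1 + ‖x₀‖) - ρ), mul_nonneg (sub_nonneg.2 h2) (sq_nonneg ρ)]
  set A := ∑ k, ∑ l, |C.sig y j k l| with hA
  set B := ∑ k, |C.b y j k| with hB
  have hA0 : 0 ≤ A := Finset.sum_nonneg fun k _ => Finset.sum_nonneg fun l _ => abs_nonneg _
  have hB0 : 0 ≤ B := Finset.sum_nonneg fun k _ => abs_nonneg _
  have hAB : A + B ≤ c * s := hgrowth y j
  have hexp : ∀ k, C.a y j k k = ∑ l, |C.sig y j k l| ^ 2 := fun k => by
    simp [a, Matrix.mul_apply, sq]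
  have htr0 : 0 ≤ ∑ k, C.a y j k k := Finset.sum_nonneg fun k _ => by
    rw [hexp]; positivity
  have htr : ∑ k, C.a y j k k ≤ A ^ 2 := by
    calc ∑ k, C.a y j k k ≤ ∑ k, (∑ l, |C.sig y j k l|) ^ 2 := Finset.sum_le_sum fun k _ => by
          rw [hexp]
          exact Finset.sum_sq_le_sq_sum_of_nonneg fun l _ => abs_nonneg _
      _ ≤ A ^ 2 := Finset.sum_sq_le_sq_sum_of_nonneg fun k _ =>
          Finset.sum_nonneg fun l _ => abs_nonneg _
  have hb : |∑ k, C.b y j k * (y - x₀) k| ≤ B * ρ := by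
    rw [hB, Finset.sum_mul]
    refine (Finset.abs_sum_le_sum_abs _ _).trans (Finset.sum_le_sum fun k _ => ?_)
    rw [abs_mul]
    gcongr
    exact abs_apply_le_norm _ k
  have hA2 : A ^ 2 ≤ c ^ 2 * s ^ 2 := by
    rw [← mul_pow]
    gcongr
    linarith
  have hB2 : 2 * (B * ρ) ≤ c * (s ^ 2 + ρ ^ 2) := by
    have h1 : B * ρ ≤ c * s * ρ := by gcongr; linarith
    nlinarith [mul_nonneg hc.le (sq_nonneg (s - ρ))]
  have hlev : C.levyMass y j ≤ L * s ^ 2 := by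
    refine (hlevy y j).trans ?_
    gcongr
    rw [hs]
    nlinarith [norm_nonneg y]
  have habs : |∑ k, C.a y j k k + 2 * ∑ k, C.b y j k * (y - x₀) k| ≤
      ∑ k, C.a y j k k + 2 * (B * ρ) := by
    refine (abs_add_le _ _).trans ?_
    rw [abs_of_nonneg htr0, abs_mul, abs_two]
    gcongr
  calc _ ≤ c ^ 2 * s ^ 2 + c * (s ^ 2 + ρ ^ 2) + L * s ^ 2 := by linarith
    _ ≤ (c ^ 2 + c + L) * (s ^ 2 + (1 + ρ ^ 2)) := by
      nlinarith [mul_nonneg hL (by positivity : 0 ≤ 1 + ρ ^ 2), sq_nonneg c,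
        mul_nonneg (sq_nonneg c) (by positivity : 0 ≤ 1 + ρ ^ 2)]
    _ ≤ (c ^ 2 + c + L) * (2 * (1 + ‖x₀‖) ^ 2 * (1 + ρ ^ 2) + (1 + ρ ^ 2)) := by gcongr
    _ = _ := by ring

theorem le_localGauss (hC : C.Admissible) {x₀ : Rd d} {K : ℝ}
    (hK : ∀ y j, |∑ k, C.a y j k k + 2 * ∑ k, C.b y j k * (y - x₀) k| + C.levyMass y j ≤
      K * (1 + ‖y - x₀‖ ^ 2)) {lam : ℝ} (hlam : 1 ≤ lam) (y : Rd d) (j : Fin m) :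
    gaussBump lam x₀ y * (2 * lam ^ 2 * ∑ k, ∑ l, (y - x₀) k * C.a y j k l * (y - x₀) l -
      lam * (K * (1 + ‖y - x₀‖ ^ 2))) ≤ C.localGauss lam x₀ y j := by
  have h1 := le_jumpGauss hC hlam x₀ y j
  have h0 := gaussBump_pos lam x₀ y
  have h2 := hK y j
  have h3 := le_abs_self (∑ k, C.a y j k k + 2 * ∑ k, C.b y j k * (y - x₀) k)
  rw [localGauss]
  set T := ∑ k, C.a y j k k + 2 * ∑ k, C.b y j k * (y - x₀) k
  have h4 : 0 ≤ lam * gaussBump lam x₀ y * (K * (1 + ‖y - x₀‖ ^ 2) - (T + C.levyMass y j)) :=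
    mul_nonneg (mul_nonneg (by linarith) h0.le) (by linarith)
  linarith

theorem exists_abs_localGauss_le (hC : C.Admissible) (x₀ : Rd d) {lam : ℝ} (hlam : 1 ≤ lam)
    (N : ℝ) : ∃ K, ∀ y j, ‖y‖ ≤ N → |C.localGauss lam x₀ y j| ≤ K := by
  obtain ⟨K, hK0, hK⟩ := exists_growth hC x₀
  have hl0 : 0 ≤ lam := zero_le_one.trans hlam
  rcases lt_or_ge N 0 with hN | hN
  · exact ⟨0, fun y j hy => absurd ((norm_nonneg y).trans hy) hN.not_ge⟩
  obtain ⟨κ, hκ, hell⟩ := hC.ellipticity _ (bddDomain_ball (0 : Rd d)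
    (by linarith : 0 < N + 1))
  set R := N + ‖x₀‖ with hR
  set E := (lam * (2 * R + 1)) ^ 2 * Real.exp (lam * (2 * R + 1)) + lam with hE
  refine ⟨1 * (2 * lam ^ 2 * (κ⁻¹ * R ^ 2) + lam * (K * (1 + R ^ 2))) + E * (K * (1 + R ^ 2)),
    fun y j hy => ?_⟩
  have hyR : ‖y - x₀‖ ≤ R := (norm_sub_le _ _).trans (by rw [hR]; linarith)
  have hq := (hell y (by simpa using hy.trans_lt (lt_add_one N)) j (y - x₀)).2
  have hq0 := quad_nonneg hC y (y - x₀) j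
  have hκ0 : 0 < κ⁻¹ := inv_pos.2 hκ.1
  have hg := hK y j
  have hm := levyMass_nonneg (C := C) y j
  have hgR : K * (1 + ‖y - x₀‖ ^ 2) ≤ K * (1 + R ^ 2) := by gcongr
  have hT := abs_nonneg (∑ k, C.a y j k k + 2 * ∑ k, C.b y j k * (y - x₀) k)
  have h0 := gaussBump_pos lam x₀ y
  have hE0 : 0 ≤ E := by
    rw [hE]; positivity
  rw [localGauss]
  refine (abs_add_le _ _).trans (add_le_add ?_ ((abs_jumpGauss_le hC hlam hyR j).trans ?_))
  · rw [abs_mul, abs_of_pos h0]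
    gcongr
    · exact gaussBump_le_one x₀ hl0 y
    · refine (abs_sub _ _).trans (add_le_add ?_ ?_)
      · rw [abs_of_nonneg (by positivity)]
        gcongr
        exact hq.trans (by gcongr)
      · rw [abs_mul, abs_of_nonneg hl0]
        gcongr
        linarith
  · gcongr
    linarith

theorem measurable_localGauss (hC : C.Admissible) (lam : ℝ) (x₀ : Rd d) (j : Fin m) :
    Measurable fun y => C.localGauss lam x₀ y j := by
  have hg : Continuous (gaussBump lam x₀) := (contDiff_gaussBump lam x₀).continuous
  have ha := continuous_a hC j
  have hb : ∀ k, Continuous fun y => C.b y j k := fun k =>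
    (EuclideanSpace.proj k).continuous.comp (hC.b_cont j)
  have hy : ∀ k, Continuous fun y : Rd d => (y - x₀) k := fun k =>
    (EuclideanSpace.proj k).continuous.comp (continuous_id.sub continuous_const)
  refine Measurable.add (Continuous.measurable ?_) (measurable_jumpGauss hC lam x₀ j)
  refine hg.mul (((continuous_finsetSum _ fun k _ => continuous_finsetSum _ fun l _ =>
    ((hy k).mul (ha k l)).mul (hy l)).const_mul _).sub (Continuous.const_mul ?_ _))
  exact (continuous_finsetSum _ fun k _ => ha k k).add
    ((continuous_finsetSum _ fun k _ => (hb k).mul (hy k)).const_mul _)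

theorem measurable_G_mul_gaussBump (hC : C.Admissible) (lam : ℝ) (x₀ : Rd d) (c : Fin m → ℝ) :
    Measurable fun p : State d m => C.G (fun y j => c j * gaussBump lam x₀ y) p.1 p.2 := by
  simp only [G_mul_gaussBump]
  refine measurable_from_prod_countable_left fun j => ?_
  have hg : Measurable (gaussBump lam x₀) := (contDiff_gaussBump lam x₀).continuous.measurable
  exact ((measurable_localGauss hC lam x₀ j).const_mul (c j)).add
    ((Finset.measurable_fun_sum Finset.univ fun k _ => (hC.q_meas j k).mul_const (c k)).mul hg)

theorem exists_abs_q_le (hC : C.Admissible) : ∃ K, 0 ≤ K ∧ ∀ y i j, |C.q y i j| ≤ K := by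
  choose K hK using hC.q_bdd
  refine ⟨∑ i, ∑ j, |K i j|, by positivity, fun y i j => ?_⟩
  calc |C.q y i j| ≤ |K i j| := (hK i j y).trans (le_abs_self _)
    _ ≤ ∑ j, |K i j| := Finset.single_le_sum (f := fun j => |K i j|)
        (fun _ _ => abs_nonneg _) (Finset.mem_univ j)
    _ ≤ _ := Finset.single_le_sum (f := fun i => ∑ j, |K i j|)
        (fun _ _ => by positivity) (Finset.mem_univ i)

theorem exists_abs_G_mul_gaussBump_le (hC : C.Admissible) (x₀ : Rd d) {lam : ℝ} (hlam : 1 ≤ lam)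
    (c : Fin m → ℝ) (N : ℝ) : ∃ K, ∀ p : State d m, ‖p.1‖ ≤ N →
      |C.G (fun y j => c j * gaussBump lam x₀ y) p.1 p.2| ≤ K := by
  obtain ⟨K, hK⟩ := exists_abs_localGauss_le hC x₀ hlam N
  obtain ⟨Kq, hKq0, hKq⟩ := exists_abs_q_le hC
  refine ⟨(∑ j, |c j|) * |K| + (∑ k, Kq * |c k|) * 1, fun ⟨y, j⟩ hy => ?_⟩
  rw [G_mul_gaussBump]
  have hl0 : 0 ≤ lam := zero_le_one.trans hlam
  refine (abs_add_le _ _).trans (add_le_add ?_ ?_)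
  · rw [abs_mul]
    refine mul_le_mul ?_ ((hK y j hy).trans (le_abs_self _)) (abs_nonneg _) (by positivity)
    exact Finset.single_le_sum (f := fun j => |c j|) (fun _ _ => abs_nonneg _) (Finset.mem_univ j)
  · rw [abs_mul, abs_of_pos (gaussBump_pos lam x₀ y)]
    refine mul_le_mul ?_ (gaussBump_le_one x₀ hl0 y) (gaussBump_pos lam x₀ y).le (by positivity)
    refine (Finset.abs_sum_le_sum_abs _ _).trans (Finset.sum_le_sum fun k _ => ?_)
    rw [abs_mul]
    gcongr
    exact hKq y j k

end Coeff

section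

open CadlagPath

variable {d m : ℕ} {C : Coeff d m}

/-- The choice of the exponent in the Lyapunov function. -/
theorem exists_exponent {γ q S Q : ℝ} (hγ : 0 < γ) (hq : 0 < q) (hQ : 0 ≤ Q) :
    ∃ lam : ℝ, 1 ≤ lam ∧ lam * S + Q + 1 ≤ lam ^ 2 * γ ∧
      (1 + (lam * S + 1) / q) * Real.exp (-lam) < 1 := by
  have hlim : Tendsto (fun lam : ℝ => (1 + 1 / q) * (lam ^ 0 * Real.exp (-lam)) +
      S / q * (lam ^ 1 * Real.exp (-lam))) atTop (𝓝 ((1 + 1 / q) * 0 + S / q * 0)) :=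
    ((Real.tendsto_pow_mul_exp_neg_atTop_nhds_zero 0).const_mul _).add
      ((Real.tendsto_pow_mul_exp_neg_atTop_nhds_zero 1).const_mul _)
  have hlt : (1 + 1 / q) * 0 + S / q * 0 < 1 := by simp
  obtain ⟨lam, h1, h2, h3⟩ := ((eventually_ge_atTop (1 : ℝ)).and
    ((eventually_ge_atTop ((S + Q + 1) / γ)).and (hlim.eventually (gt_mem_nhds hlt)))).exists
  refine ⟨lam, h1, ?_, ?_⟩
  · rw [div_le_iff₀ hγ] at h2
    have : lam * (S + Q + 1) ≤ lam * (lam * γ) := by gcongr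
    nlinarith
  · refine lt_of_eq_of_lt ?_ h3
    field_simp
    ring

/-- Strict irreducibility gives a common lower bound for the rates into the state `l`. -/
theorem Coeff.StrictlyIrreducible.exists_rate {E : Set (Rd d)} (h : C.StrictlyIrreducible E)
    (l : Fin m) : ∃ q0 > (0 : ℝ), ∀ x ∈ E, ∀ j, j ≠ l → q0 ≤ C.q x j l := by
  have h' : ∀ j, ∃ q0 > (0 : ℝ), j ≠ l → ∀ x ∈ E, q0 ≤ C.q x j l := fun j => by
    by_cases hj : j = l
    · exact ⟨1, one_pos, fun h => absurd hj h⟩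
    · obtain ⟨q0, hq, hx⟩ := h j l hj
      exact ⟨q0, hq, fun _ => hx⟩
  choose g hg hgq using h'
  have : Nonempty (Fin m) := ⟨l⟩
  obtain ⟨j₀, hj₀⟩ := Finite.exists_min g
  exact ⟨g j₀, hg j₀, fun x hx j hj => (hj₀ j).trans (hgq j hj x hx)⟩

/-- Started in `D`, the process visits `D × {l}` with a probability bounded away from zero. -/
theorem exists_le_prob_exists_mem (hC : C.Admissible)
    {P : ProbabilityTheory.Kernel (State d m) (CadlagPath d m)}
    (hP : ∀ x i, SolvesMartingaleProblem C x i (P (x, i)))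
    (hirr : ∀ E : Set (Rd d), BddDomain E → C.StrictlyIrreducible E)
    {D : Set (Rd d)} (hD : BddDomain D) (l : Fin m) :
    ∃ δ > (0 : ℝ), ∀ x ∈ D, ∀ i,
      δ ≤ (P (x, i)).real {w | ∃ t, Z t w ∈ D ×ˢ ({l} : Set (Fin m))} := by
  obtain ⟨x₀, hx₀⟩ := hD.2.1.nonempty
  obtain ⟨r, hr, hrD⟩ := Metric.isOpen_iff.1 hD.1 x₀ hx₀
  obtain ⟨R₁, hR₁0, hR₁⟩ := hD.2.2.subset_ball_lt 0 x₀
  set R := R₁ + 1 with hR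
  have hE : BddDomain (ball x₀ (R + 1)) := bddDomain_ball x₀ (by linarith)
  obtain ⟨κ, hκ, hell⟩ := hC.ellipticity _ hE
  obtain ⟨q0, hq0, hq⟩ := (hirr _ hE).exists_rate l
  obtain ⟨K, hK0, hK⟩ := Coeff.exists_growth hC x₀
  obtain ⟨Q, hQ0, hQ⟩ := Coeff.exists_abs_q_le hC
  set S := K * (1 + R ^ 2) with hS
  have hS0 : 0 ≤ S := by positivity
  have hκ0 := hκ.1
  obtain ⟨lam, hlam, hlam2, hlam3⟩ :=
    exists_exponent (γ := 2 * κ * r ^ 2) (by positivity) hq0 hQ0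
  have hl0 : 0 ≤ lam := zero_le_one.trans hlam
  set A := (lam * S + 1) / q0 with hA
  have hA0 : 0 ≤ A := by positivity
  have hAq : A * q0 = lam * S + 1 := div_mul_cancel₀ _ hq0.ne'
  let c : Fin m → ℝ := fun j => 1 + if j = l then A else 0
  have hc1 : ∀ j, 1 ≤ c j := fun j => by
    simp only [c]; split_ifs <;> linarith
  have hcA : ∀ j, c j ≤ 1 + A := fun j => by
    simp only [c]; split_ifs <;> linarith
  have hqc : ∀ y j, ∑ k, C.q y j k * c k = A * C.q y j l := fun y j => by
    simp only [c, mul_add, Finset.sum_add_distrib, mul_one, hC.q_rowsum, mul_ite, mul_zero,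
      Finset.sum_ite_eq', Finset.mem_univ, if_true, zero_add]
    ring
  set φ := gaussBump lam x₀ with hφ
  have hφ0 : ∀ y, 0 < φ y := gaussBump_pos lam x₀
  have hφ1 : ∀ y, φ y ≤ 1 := gaussBump_le_one x₀ hl0
  have hloc : ∀ y j, φ y * (2 * lam ^ 2 * ∑ k, ∑ l, (y - x₀) k * C.a y j k l * (y - x₀) l -
      lam * (K * (1 + ‖y - x₀‖ ^ 2))) ≤ C.localGauss lam x₀ y j := Coeff.le_localGauss hC hK hlam
  have hG : ∀ y j, C.G (fun y j => c j * φ y) y j =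
      c j * C.localGauss lam x₀ y j + A * C.q y j l * φ y := fun y j => by
    rw [C.G_mul_gaussBump lam x₀ c y j, hqc]
  let U : Set (State d m) := ball x₀ r ×ˢ ({l} : Set (Fin m))
  let V : Set (State d m) := U ∪ (closedBall x₀ R)ᶜ ×ˢ (univ : Set (Fin m))
  have hU : IsOpen U := isOpen_ball.prod (isOpen_discrete _)
  have hV : IsOpen V := hU.union (isClosed_closedBall.isOpen_compl.prod isOpen_univ)
  have hGc : ∀ p : State d m, p ∉ V → Real.exp (-lam * R ^ 2) ≤
      C.G (fun y j => c j * φ y) p.1 p.2 := by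
    rintro ⟨y, j⟩ hp
    simp only [V, U, mem_union, mem_prod, mem_ball, mem_singleton_iff, mem_compl_iff,
      mem_closedBall, mem_univ, and_true, not_or, not_and, not_not, dist_eq_norm] at hp
    obtain ⟨hpU, hρ⟩ := hp
    have hφR : Real.exp (-lam * R ^ 2) ≤ φ y := by
      rw [hφ, gaussBump, Real.exp_le_exp]
      have : lam * ‖y - x₀‖ ^ 2 ≤ lam * R ^ 2 := by gcongr
      linarith
    refine hφR.trans ?_
    have hyE : y ∈ ball x₀ (R + 1) := by
      rw [mem_ball, dist_eq_norm]; linarith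
    have hKS : lam * (K * (1 + ‖y - x₀‖ ^ 2)) ≤ lam * S := by
      rw [hS]; gcongr
    have hL := hloc y j
    rw [hG]
    by_cases hj : j = l
    · have hrρ : r ≤ ‖y - x₀‖ := not_lt.1 fun h => hpU h hj
      have hquad : κ * r ^ 2 ≤ ∑ k, ∑ l, (y - x₀) k * C.a y j k l * (y - x₀) l :=
        le_trans (by gcongr) (hell y hyE j (y - x₀)).1
      have hbr : Q + 1 ≤ 2 * lam ^ 2 * (∑ k, ∑ l, (y - x₀) k * C.a y j k l * (y - x₀) l) -
          lam * (K * (1 + ‖y - x₀‖ ^ 2)) := by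
        nlinarith [mul_le_mul_of_nonneg_left hquad (sq_nonneg lam)]
      have hL' : φ y * (Q + 1) ≤ C.localGauss lam x₀ y j :=
        (mul_le_mul_of_nonneg_left hbr (hφ0 y).le).trans hL
      have hcj : c j = 1 + A := by simp [c, hj]
      have hqQ : -Q ≤ C.q y j l := (abs_le.1 (hQ y j l)).1
      have h1 : A * (-Q) * φ y ≤ A * C.q y j l * φ y := by
        have := (hφ0 y).le
        gcongr
      have h2 : (1 + A) * (φ y * (Q + 1)) ≤ (1 + A) * C.localGauss lam x₀ y j := by gcongr
      rw [hcj]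
      nlinarith [mul_nonneg hQ0 (hφ0 y).le, mul_nonneg hA0 (hφ0 y).le]
    · have hcj : c j = 1 := by simp [c, hj]
      have hquad := Coeff.quad_nonneg hC y (y - x₀) j
      have hbr : -(lam * S) ≤ 2 * lam ^ 2 *
          (∑ k, ∑ l, (y - x₀) k * C.a y j k l * (y - x₀) l) -
          lam * (K * (1 + ‖y - x₀‖ ^ 2)) := by
        nlinarith [mul_nonneg (sq_nonneg lam) hquad]
      have hL' : φ y * -(lam * S) ≤ C.localGauss lam x₀ y j :=
        (mul_le_mul_of_nonneg_left hbr (hφ0 y).le).trans hL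
      have h1 : A * q0 * φ y ≤ A * C.q y j l * φ y := by
        have := (hφ0 y).le
        have := hq y hyE j hj
        gcongr
      rw [hAq] at h1
      rw [hcj]
      linarith
  have hGK : ∀ p : State d m, -((1 + A) * (lam * (K * 2)) + A * Q) ≤
      C.G (fun y j => c j * φ y) p.1 p.2 := by
    rintro ⟨y, j⟩
    rw [hG]
    have hquad := Coeff.quad_nonneg hC y (y - x₀) j
    have h2 := norm_sq_mul_gaussBump_le x₀ hlam y
    have hL : -(lam * (K * 2)) ≤ C.localGauss lam x₀ y j := by
      refine le_trans ?_ (hloc y j)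
      have h3 : lam * K * ((1 + ‖y - x₀‖ ^ 2) * φ y) ≤ lam * K * 2 := by gcongr
      have h4 : 0 ≤ φ y * (2 * lam ^ 2 *
          ∑ k, ∑ l, (y - x₀) k * C.a y j k l * (y - x₀) l) :=
        mul_nonneg (hφ0 y).le (by positivity)
      linarith
    have hM0 : 0 ≤ lam * (K * 2) := by positivity
    have h5 : -((1 + A) * (lam * (K * 2))) ≤ c j * C.localGauss lam x₀ y j := by
      have e1 : c j * -(lam * (K * 2)) ≤ c j * C.localGauss lam x₀ y j :=
        mul_le_mul_of_nonneg_left hL (zero_le_one.trans (hc1 j))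
      have e2 := mul_le_mul_of_nonneg_right (hcA j) hM0
      linarith
    have h6 : -(A * Q) ≤ A * C.q y j l * φ y := by
      have e1 : |C.q y j l * φ y| ≤ Q * 1 := by
        rw [abs_mul, abs_of_pos (hφ0 y)]
        exact mul_le_mul (hQ y j l) (hφ1 y) (hφ0 y).le hQ0
      have e2 := mul_le_mul_of_nonneg_left (abs_le.1 e1).1 hA0
      linarith
    linarith
  have hfε : ∀ p : State d m, p ∈ V → p ∉ U →
      c p.2 * φ p.1 ≤ (1 + A) * Real.exp (-lam * R ^ 2) := by
    rintro ⟨y, j⟩ hpV hpU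
    have hp := hpV.resolve_left hpU
    simp only [mem_prod, mem_compl_iff, mem_closedBall, dist_eq_norm, not_le, mem_univ,
      and_true] at hp
    have hφR : φ y ≤ Real.exp (-lam * R ^ 2) := by
      rw [hφ, gaussBump, Real.exp_le_exp]
      have : lam * R ^ 2 ≤ lam * ‖y - x₀‖ ^ 2 := by gcongr
      linarith
    exact mul_le_mul (hcA j) hφR (hφ0 y).le (by linarith)
  have hexp : (1 + A) * Real.exp (-lam * R ^ 2) < Real.exp (-lam * R₁ ^ 2) := by
    have h1 : Real.exp (-lam * R ^ 2) ≤ Real.exp (-lam) * Real.exp (-lam * R₁ ^ 2) := by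
      rw [← Real.exp_add, Real.exp_le_exp, hR]
      nlinarith [mul_nonneg hl0 hR₁0.le]
    calc (1 + A) * Real.exp (-lam * R ^ 2)
        ≤ (1 + A) * (Real.exp (-lam) * Real.exp (-lam * R₁ ^ 2)) := by gcongr
      _ = (1 + A) * Real.exp (-lam) * Real.exp (-lam * R₁ ^ 2) := by ring
      _ < 1 * Real.exp (-lam * R₁ ^ 2) := by gcongr
      _ = _ := one_mul _
  refine ⟨(Real.exp (-lam * R₁ ^ 2) - (1 + A) * Real.exp (-lam * R ^ 2)) / (1 + A),
    div_pos (by linarith) (by linarith), fun x hx i => ?_⟩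
  have := (hP x i).prob
  have key := (hP x i).le_prob_exists_mem (isCb2_mul_gaussBump x₀ hlam c)
    (Coeff.measurable_G_mul_gaussBump hC lam x₀ c)
    (Coeff.exists_abs_G_mul_gaussBump_le hC x₀ hlam c) hU hV (Real.exp_pos (-lam * R ^ 2))
    (by linarith : 0 ≤ 1 + A) (mul_nonneg (by linarith) (Real.exp_pos (-lam * R ^ 2)).le)
    (fun y j => (mul_le_mul (hcA j) (hφ1 y) (hφ0 y).le (by linarith)).trans_eq (mul_one _))
    hfε hGc hGK
  have hstart : Real.exp (-lam * R₁ ^ 2) ≤ c i * φ x := by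
    have hxR : ‖x - x₀‖ ≤ R₁ := by
      rw [← dist_eq_norm]; exact (mem_ball.1 (hR₁ hx)).le
    have h1 : Real.exp (-lam * R₁ ^ 2) ≤ φ x := by
      rw [hφ, gaussBump, Real.exp_le_exp]
      have : lam * ‖x - x₀‖ ^ 2 ≤ lam * R₁ ^ 2 := by gcongr
      linarith
    exact h1.trans (le_mul_of_one_le_left (hφ0 x).le (hc1 i))
  have hsub : (P (x, i)).real {w | ∃ t, Z t w ∈ U} ≤
      (P (x, i)).real {w | ∃ t, Z t w ∈ D ×ˢ ({l} : Set (Fin m))} :=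
    measureReal_mono fun w ⟨t, ht⟩ => ⟨t, hrD ht.1, ht.2⟩
  rw [div_le_iff₀' (by linarith)]
  have := mul_le_mul_of_nonneg_left hsub (by linarith : 0 ≤ 1 + A)
  linarith

end

theorem recurrence_with_fixed_discrete_component {d m : ℕ} (hd : 1 ≤ d) (hm : 1 ≤ m)
    (C : Coeff d m) (hC : C.Admissible)
    (P : ProbabilityTheory.Kernel (State d m) (CadlagPath d m)) (hP : IsSwitchingJumpDiffusion C P)
    (hirr : ∀ E : Set (Rd d), BddDomain E → C.StrictlyIrreducible E)
    (D : Set (Rd d)) (hD : BddDomain D)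
    (hrec : ∀ (y : Rd d) (j : Fin m), y ∉ D → P (y, j) {w | CadlagPath.sigmaX D w < ⊤} = 1) :
    ∀ (x : Rd d) (i l : Fin m),
      P (x, i) {w | CadlagPath.sigmaZ (D ×ˢ ({l} : Set (Fin m))) w < ⊤} = 1 := by
  intro x i l
  have : ProbabilityTheory.IsMarkovKernel P := ⟨fun p => (hP.solves p.1 p.2).prob⟩
  obtain ⟨δ, hδ, hbound⟩ := exists_le_prob_exists_mem hC hP.solves hirr hD l
  have hopen : IsOpen (D ×ˢ ({l} : Set (Fin m))) := hD.1.prod (isOpen_discrete _)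
  have hin : ∀ p ∈ D ×ˢ (univ : Set (Fin m)), ENNReal.ofReal δ ≤
      P p {w | ∃ t, CadlagPath.Z t w ∈ D ×ˢ ({l} : Set (Fin m))} := fun p hp =>
    ENNReal.ofReal_le_of_le_toReal (hbound p.1 hp.1 p.2)
  have hall : ∀ p, ENNReal.ofReal δ ≤ P p {w | ∃ t, CadlagPath.Z t w ∈ D ×ˢ ({l} : Set (Fin m))} := fun p => by
    by_cases hp : p.1 ∈ D
    · exact hin p ⟨hp, mem_univ _⟩
    · refine hP.strongMarkov.le_prob_exists_mem hopen (hD.1.prod isOpen_univ) hin p ?_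
      have := hrec p.1 p.2 hp
      simp only [CadlagPath.sigmaX_lt_top_iff] at this
      simpa [CadlagPath.X] using this
  simp only [CadlagPath.sigmaZ_lt_top_iff]
  exact hP.strongMarkov.prob_exists_mem_eq_one hopen (ENNReal.ofReal_pos.2 hδ) hall (x, i)
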